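/- Let n ≥ 3 and let C(s), s ∈ [0,1), be a family of closed convex SO(n)-invariant cones in S²_B(so(n)) with nonempty interior, depending continuously on s (in the Hausdorff distance of the truncations C(s) ∩ {‖R‖ ≤ 1}), such that every nonzero R ∈ C(s) has positive scalar curvature and, for every s ∈ (0,1) and every nonzero R ∈ C(s), the operator R² + R^# lies in the interior of the tangent cone T_R C(s). Then for every ε ∈ (0,1) and every h₀ > 0 there exists a closed convex SO(n)-invariant subset F ⊆ S²_B(so(n)) with the following properties: (1) F is invariant under the ordinary differential equation dR/dt = R² + R^#, i.e. every differentiable curve R : [0,T) → S²_B(so(n)) with R'(t) = R(t)² + R(t)^# for all t and R(0) ∈ F satisfies R(t) ∈ F for all t ∈ [0,T); (2) C(ε) ∩ {R : tr(R) ≤ h₀} ⊆ F; (3) F ∖ C(s) is bounded for every s ∈ [ε,1). -/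

import Mathlib

/-!
Common setup: we identify ⋀²ℝⁿ with the Lie algebra `so n` of real skew-symmetric
`n × n` matrices, sending `eᵢ ∧ eⱼ` to the rotation by `π/2` in the plane spanned by
`eᵢ, eⱼ`; the inner product on `so n` is `⟪A, B⟫ = -(1/2)·tr (A * B)`, and under this
identification `v ∧ w` corresponds to the skew-symmetric matrix `v wᵀ - w vᵀ`, while
the wedge `A ∧ B` of two endomorphisms of `ℝⁿ` acts on a skew matrix `M` by
`M ↦ (1/2)(A M Bᵀ + B M Aᵀ)` (the unique linear extension of
`v∧w ↦ (1/2)(Av ∧ Bw + Bv ∧ Aw)`).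
-/

noncomputable section

namespace BW

open Matrix

abbrev Mat (n : ℕ) := Matrix (Fin n) (Fin n) ℝ

/-- `so n`: the space of real skew-symmetric `n × n` matrices (≅ ⋀²ℝⁿ). -/
def so (n : ℕ) : Submodule ℝ (Mat n) where
  carrier := {A | Aᵀ = -A}
  add_mem' := by
    intro A B hA hB
    simp only [Set.mem_setOf_eq] at *
    rw [Matrix.transpose_add, hA, hB, neg_add]
  zero_mem' := by simp
  smul_mem' := by
    intro c A hA
    simp only [Set.mem_setOf_eq] at *
    rw [Matrix.transpose_smul, hA, smul_neg]

variable {n : ℕ}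

lemma mem_so_iff {A : Mat n} : A ∈ so n ↔ Aᵀ = -A := Iff.rfl

/-- The inner product `⟨A,B⟩ = -(1/2)·tr(AB)` on `so n`. -/
def ip (A B : so n) : ℝ := -(1/2) * Matrix.trace ((A : Mat n) * (B : Mat n))

/-- `ip` as a linear map in the second variable. -/
def ipL (A : so n) : so n →ₗ[ℝ] ℝ where
  toFun B := ip A B
  map_add' B C := by
    simp only [ip, Submodule.coe_add, Matrix.mul_add, Matrix.trace_add]; ring
  map_smul' c B := by
    simp only [ip, SetLike.val_smul, Matrix.mul_smul, Matrix.trace_smul, smul_eq_mul,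
      RingHom.id_apply]; ring

/-- The Lie bracket (matrix commutator) on `so n`. -/
def brk (A B : so n) : so n :=
  ⟨(A : Mat n) * (B : Mat n) - (B : Mat n) * (A : Mat n), by
    have hA : (A : Mat n)ᵀ = -(A : Mat n) := A.2
    have hB : (B : Mat n)ᵀ = -(B : Mat n) := B.2
    rw [mem_so_iff, Matrix.transpose_sub, Matrix.transpose_mul, Matrix.transpose_mul, hA, hB]
    noncomm_ring⟩

/-- Auxiliary linear map underlying `A ∧ B`. -/
def wedgeAux (A B : Mat n) : Mat n →ₗ[ℝ] Mat n where
  toFun M := (1/2 : ℝ) • (A * M * Bᵀ + B * M * Aᵀ)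
  map_add' M N := by
    simp only [mul_add, add_mul, smul_add]
    module
  map_smul' c M := by
    simp only [mul_smul_comm, smul_mul_assoc, RingHom.id_apply]
    module

lemma wedgeAux_mem (A B : Mat n) : ∀ M ∈ so n, wedgeAux A B M ∈ so n := by
  intro M hM
  rw [mem_so_iff] at hM ⊢
  show ((1/2 : ℝ) • (A * M * Bᵀ + B * M * Aᵀ))ᵀ = -((1/2 : ℝ) • (A * M * Bᵀ + B * M * Aᵀ))
  rw [Matrix.transpose_smul, Matrix.transpose_add, Matrix.transpose_mul, Matrix.transpose_mul,
    Matrix.transpose_mul, Matrix.transpose_mul, Matrix.transpose_transpose,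
    Matrix.transpose_transpose, hM]
  simp only [Matrix.neg_mul, Matrix.mul_neg, Matrix.mul_assoc, smul_neg, neg_add, smul_add]
  abel

/-- The wedge `A ∧ B` of two endomorphisms of ℝⁿ, as an endomorphism of `so n ≅ ⋀²ℝⁿ`:
the unique linear map with `(A ∧ B)(v ∧ w) = (1/2)(Av ∧ Bw + Bv ∧ Aw)`. -/
def wedge (A B : Mat n) : Module.End ℝ (so n) :=
  (wedgeAux A B).restrict (p := so n) (q := so n) (wedgeAux_mem A B)

/-- The index set of pairs `i < j`. -/
def pairs (n : ℕ) : Finset (Fin n × Fin n) := Finset.univ.filter fun p => p.1 < p.2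

/-- The standard basis vector `eᵢ` of ℝⁿ. -/
def evec (i : Fin n) : Fin n → ℝ := fun k => if k = i then 1 else 0

/-- `v ∧ w`, as an element of `so n ≅ ⋀²ℝⁿ`. -/
def vwedge (v w : Fin n → ℝ) : so n :=
  ⟨Matrix.of fun i j => v i * w j - w i * v j, by
    rw [mem_so_iff]
    ext i j
    simp only [Matrix.transpose_apply, Matrix.of_apply, Matrix.neg_apply]
    ring⟩

/-- The orthonormal basis vector `eᵢ ∧ eⱼ` of `so n ≅ ⋀²ℝⁿ`. -/
def bvec (i j : Fin n) : so n := vwedge (evec i) (evec j)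

/-- Hamilton's sharp product `R # S`: the self-adjoint endomorphism of `so n` determined by
`⟨(R#S)h, h⟩ = (1/2)·Σ_{α,β} ⟨[R(b_α), S(b_β)], h⟩·⟨[b_α, b_β], h⟩`,
where `(b_α)` is the orthonormal basis `(eᵢ ∧ eⱼ)_{i<j}` of `so n`. -/
def sharp (R S : Module.End ℝ (so n)) : Module.End ℝ (so n) :=
  (1/4 : ℝ) • ∑ p ∈ pairs n, ∑ q ∈ pairs n,
    ((ipL (brk (R (bvec p.1 p.2)) (S (bvec q.1 q.2)))).smulRight
        (brk (bvec p.1 p.2) (bvec q.1 q.2))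
      + (ipL (brk (bvec p.1 p.2) (bvec q.1 q.2))).smulRight
        (brk (R (bvec p.1 p.2)) (S (bvec q.1 q.2))))

/-- The right-hand side `R² + R^#` of Hamilton's ODE. -/
def Qode (R : Module.End ℝ (so n)) : Module.End ℝ (so n) := R * R + sharp R R

/-- The coordinates `R_{ijkl} = ⟨R(eᵢ∧eⱼ), e_k∧e_l⟩` of an endomorphism of `so n`. -/
def Rcoord (R : Module.End ℝ (so n)) (i j k l : Fin n) : ℝ := ip (R (bvec i j)) (bvec k l)

/-- Self-adjointness with respect to the inner product `ip`. -/
def selfAdjEnd (R : Module.End ℝ (so n)) : Prop := ∀ X Y : so n, ip (R X) Y = ip X (R Y)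

/-- A curvature operator: a self-adjoint endomorphism of `so n ≅ ⋀²ℝⁿ` satisfying the
first Bianchi identity.  (`isCurvOp` carves out `S²_B(so n)`.) -/
def isCurvOp (R : Module.End ℝ (so n)) : Prop :=
  selfAdjEnd R ∧
    ∀ i j k l : Fin n, Rcoord R i j k l + Rcoord R j k i l + Rcoord R k i j l = 0

/-- The Ricci tensor `Ric_{ij} = Σ_k R_{ikjk}` of `R`. -/
def RicM (R : Module.End ℝ (so n)) : Mat n := Matrix.of fun i j => ∑ k, Rcoord R i k j k

/-- `λ̄ = tr(Ric)/n`. -/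
def lamb (R : Module.End ℝ (so n)) : ℝ := Matrix.trace (RicM R) / (n : ℝ)

/-- The traceless Ricci tensor `Ric₀ = Ric - (tr Ric / n)·id`. -/
def Ric0 (R : Module.End ℝ (so n)) : Mat n := RicM R - lamb R • (1 : Mat n)

/-- `σ = tr(Ric₀²)/n`. -/
def sigmaR (R : Module.End ℝ (so n)) : ℝ := Matrix.trace (Ric0 R * Ric0 R) / (n : ℝ)

/-- `R_I = (λ̄/(n-1))·(id ∧ id)`, the projection of `R` onto `⟨I⟩`. -/
def RI (R : Module.End ℝ (so n)) : Module.End ℝ (so n) :=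
  (lamb R / ((n : ℝ) - 1)) • wedge (1 : Mat n) (1 : Mat n)

/-- `R_{Ric₀} = (2/(n-2))·(Ric₀ ∧ id)`, the projection of `R` onto `⟨Ric₀⟩`. -/
def RRic0 (R : Module.End ℝ (so n)) : Module.End ℝ (so n) :=
  (2 / ((n : ℝ) - 2)) • wedge (Ric0 R) (1 : Mat n)

/-- The linear map `ℓ_{a,b}(R) = R + 2(n-1)a·R_I + (n-2)b·R_{Ric₀}`. -/
def lab (a b : ℝ) (R : Module.End ℝ (so n)) : Module.End ℝ (so n) :=
  R + (2 * ((n : ℝ) - 1) * a) • RI R + (((n : ℝ) - 2) * b) • RRic0 R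

/-- Positive semidefiniteness of the quadratic form of an endomorphism of `so n`. -/
def posSemidefEnd (R : Module.End ℝ (so n)) : Prop := ∀ X : so n, 0 ≤ ip (R X) X

/-- Positive definiteness of the quadratic form of an endomorphism of `so n`. -/
def posDefEnd (R : Module.End ℝ (so n)) : Prop := ∀ X : so n, X ≠ 0 → 0 < ip (R X) X

/-- `R` is 2-nonnegative: the sum of its two smallest eigenvalues is nonnegative;
equivalently (Ky Fan), `q_R(X) + q_R(Y) ≥ 0` for all orthonormal pairs `X, Y`. -/
def twoNonneg (R : Module.End ℝ (so n)) : Prop :=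
  ∀ X Y : so n, ip X X = 1 → ip Y Y = 1 → ip X Y = 0 → 0 ≤ ip (R X) X + ip (R Y) Y

/-- The (Frobenius) norm of an endomorphism of `so n`, computed in the orthonormal
basis `(eᵢ ∧ eⱼ)_{i<j}`. -/
def endNorm (R : Module.End ℝ (so n)) : ℝ :=
  Real.sqrt (∑ p ∈ pairs n, ip (R (bvec p.1 p.2)) (R (bvec p.1 p.2)))

/-- The tangent cone `T_R C`: the closure of `{t·(S - R) : S ∈ C, t ≥ 0}`. -/
def tangCone (C : Set (Module.End ℝ (so n))) (R : Module.End ℝ (so n)) :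
    Set (Module.End ℝ (so n)) :=
  {X | ∀ ε > 0, ∃ S ∈ C, ∃ t : ℝ, 0 ≤ t ∧ endNorm (X - t • (S - R)) < ε}

/-- `C` is a closed subset of the space of endomorphisms of `so n`. -/
def isClosedSet (C : Set (Module.End ℝ (so n))) : Prop :=
  ∀ X, (∀ ε > 0, ∃ Y ∈ C, endNorm (X - Y) < ε) → X ∈ C

/-- The interior of `C` relative to the subspace `S²_B(so n)` of curvature operators. -/
def interiorCurv (C : Set (Module.End ℝ (so n))) : Set (Module.End ℝ (so n)) :=
  {X | isCurvOp X ∧ ∃ ε > 0, ∀ Y, isCurvOp Y → endNorm (Y - X) < ε → Y ∈ C}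

/-- Auxiliary linear map `M ↦ g M gᵀ` on matrices. -/
def conjAux (g : Mat n) : Mat n →ₗ[ℝ] Mat n where
  toFun M := g * M * gᵀ
  map_add' M N := by simp only [mul_add, add_mul]
  map_smul' c M := by simp only [mul_smul_comm, smul_mul_assoc, RingHom.id_apply]

/-- `⋀²g` : the action `M ↦ g M gᵀ` of `g` on `so n ≅ ⋀²ℝⁿ` (for `g` orthogonal this is
the second exterior power of `g`). -/
def conjSo (g : Mat n) : Module.End ℝ (so n) :=
  (conjAux g).restrict (p := so n) (q := so n) (fun M hM => by
    rw [mem_so_iff] at hM ⊢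
    show (g * M * gᵀ)ᵀ = -(g * M * gᵀ)
    rw [Matrix.transpose_mul, Matrix.transpose_mul, Matrix.transpose_transpose, hM]
    simp only [Matrix.neg_mul, Matrix.mul_neg, Matrix.mul_assoc])

/-- The action `g · R = (⋀²g) ∘ R ∘ (⋀²g)⁻¹` of an orthogonal matrix `g`
(whose inverse is `gᵀ`) on endomorphisms of `so n`. -/
def onAct (g : Mat n) (R : Module.End ℝ (so n)) : Module.End ℝ (so n) :=
  conjSo g * R * conjSo gᵀ

/-- Two sets are at Hausdorff distance at most `ε` from each other. -/
def hdClose (A B : Set (Module.End ℝ (so n))) (ε : ℝ) : Prop :=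
  (∀ X ∈ A, ∃ Y ∈ B, endNorm (X - Y) ≤ ε) ∧ ∀ Y ∈ B, ∃ X ∈ A, endNorm (X - Y) ≤ ε

/-- The truncation `C ∩ {‖R‖ ≤ 1}`. -/
def truncSet (C : Set (Module.End ℝ (so n))) : Set (Module.End ℝ (so n)) :=
  {R ∈ C | endNorm R ≤ 1}

section Abstract

/-! ### Pinching families in a finite-dimensional normed space -/

open Set Filter Topology

/-- A continuous family of closed convex cones in a normed space, all containing `e` in their
interior, together with a quadratic vector field `Q` pointing into the interior of the cones,
a linear functional `ℓ` which is positive on them, and a set `G` of linear symmetries. -/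
structure PinchingFamily (V : Type*) [NormedAddCommGroup V] [NormedSpace ℝ V] where
  C : ℝ → Set V
  e : V
  ℓ : V →L[ℝ] ℝ
  Q : V → V
  M : ℝ
  G : Set (V →ₗ[ℝ] V)
  closed : ∀ s ∈ Ico (0 : ℝ) 1, IsClosed (C s)
  convex : ∀ s ∈ Ico (0 : ℝ) 1, Convex ℝ (C s)
  smul_mem : ∀ s ∈ Ico (0 : ℝ) 1, ∀ X ∈ C s, ∀ t : ℝ, 0 ≤ t → t • X ∈ C s
  e_mem : ∀ s ∈ Ico (0 : ℝ) 1, e ∈ interior (C s)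
  hausdorff : ∀ s₀ ∈ Ico (0 : ℝ) 1, ∀ θ > (0 : ℝ), ∀ᶠ s in 𝓝[Ico (0 : ℝ) 1] s₀,
    (∀ X ∈ C s, ‖X‖ ≤ 1 → ∃ Y ∈ C s₀, ‖X - Y‖ ≤ θ) ∧
      ∀ X ∈ C s₀, ‖X‖ ≤ 1 → ∃ Y ∈ C s, ‖X - Y‖ ≤ θ
  pos : ∀ s ∈ Ico (0 : ℝ) 1, ∀ X ∈ C s, X ≠ 0 → 0 < ℓ X
  M_nonneg : 0 ≤ M
  lipschitz : ∀ X Y, ‖Q X - Q Y‖ ≤ M * ‖X - Y‖ * (‖X‖ + ‖Y‖)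
  Q_smul : ∀ (t : ℝ) X, Q (t • X) = t ^ 2 • Q X
  tangent : ∀ s ∈ Ioo (0 : ℝ) 1, ∀ X ∈ C s, X ≠ 0 → ∃ δ > (0 : ℝ), ∀ Y, ‖Y - Q X‖ < δ →
    ∀ ρ > (0 : ℝ), ∃ S ∈ C s, ∃ t : ℝ, 0 ≤ t ∧ ‖Y - t • (S - X)‖ < ρ
  G_C : ∀ g ∈ G, ∀ s ∈ Ico (0 : ℝ) 1, ∀ X ∈ C s, g X ∈ C s
  G_e : ∀ g ∈ G, g e = e
  G_ℓ : ∀ g ∈ G, ∀ X, ℓ (g X) = ℓ X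

/-- Invariance of a set under the differential equation `R' = Q R`. -/
def ODEInvariant {V : Type*} [NormedAddCommGroup V] [NormedSpace ℝ V] (Q : V → V)
    (S : Set V) : Prop :=
  ∀ (T : ℝ) (R : ℝ → V),
    (∀ t ∈ Ico (0 : ℝ) T, HasDerivWithinAt R (Q (R t)) (Ico (0 : ℝ) T) t) →
    R 0 ∈ S → ∀ t ∈ Ico (0 : ℝ) T, R t ∈ S

namespace PinchingFamily

variable {V : Type*} [NormedAddCommGroup V] [NormedSpace ℝ V] (𝓕 : PinchingFamily V)
  {s : ℝ}

lemma add_mem (hs : s ∈ Ico (0 : ℝ) 1) {X Y : V} (hX : X ∈ 𝓕.C s) (hY : Y ∈ 𝓕.C s) :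
    X + Y ∈ 𝓕.C s := by
  have h := 𝓕.smul_mem s hs _ (𝓕.convex s hs hX hY (a := 1 / 2) (b := 1 / 2) (by norm_num)
    (by norm_num) (by norm_num)) 2 (by norm_num)
  convert h using 1
  module

lemma e_mem' (hs : s ∈ Ico (0 : ℝ) 1) : 𝓕.e ∈ 𝓕.C s := interior_subset (𝓕.e_mem s hs)

lemma zero_mem (hs : s ∈ Ico (0 : ℝ) 1) : (0 : V) ∈ 𝓕.C s := by
  simpa using 𝓕.smul_mem s hs _ (𝓕.e_mem' hs) 0 le_rfl

lemma add_smul_e_mem (hs : s ∈ Ico (0 : ℝ) 1) {X : V} (hX : X ∈ 𝓕.C s) {t : ℝ} (ht : 0 ≤ t) :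
    X + t • 𝓕.e ∈ 𝓕.C s :=
  𝓕.add_mem hs hX (𝓕.smul_mem s hs _ (𝓕.e_mem' hs) t ht)

lemma add_mem_interior (hs : s ∈ Ico (0 : ℝ) 1) {X Y : V} (hX : X ∈ 𝓕.C s)
    (hY : Y ∈ interior (𝓕.C s)) : X + Y ∈ interior (𝓕.C s) := by
  refine interior_maximal (t := (fun Z => X + Z) '' interior (𝓕.C s)) ?_ ?_ ⟨Y, hY, rfl⟩
  · rintro _ ⟨Z, hZ, rfl⟩
    exact 𝓕.add_mem hs hX (interior_subset hZ)
  · exact (Homeomorph.addLeft X).isOpenMap _ isOpen_interior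

lemma smul_mem_interior (hs : s ∈ Ico (0 : ℝ) 1) {X : V} (hX : X ∈ interior (𝓕.C s)) {t : ℝ}
    (ht : 0 < t) : t • X ∈ interior (𝓕.C s) := by
  refine interior_maximal (t := (fun Z => t • Z) '' interior (𝓕.C s)) ?_ ?_ ⟨X, hX, rfl⟩
  · rintro _ ⟨Z, hZ, rfl⟩
    exact 𝓕.smul_mem s hs _ (interior_subset hZ) t ht.le
  · exact (Homeomorph.smulOfNeZero t ht.ne').isOpenMap _ isOpen_interior

lemma smul_e_add_mem_interior (hs : s ∈ Ico (0 : ℝ) 1) {r : ℝ} (hr : 0 < r)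
    (h : Metric.ball 𝓕.e r ⊆ 𝓕.C s) {t : ℝ} {v : V} (hv : ‖v‖ < t * r) :
    t • 𝓕.e + v ∈ interior (𝓕.C s) := by
  have ht : 0 < t := pos_of_mul_pos_left ((norm_nonneg v).trans_lt hv) hr.le
  have h1 : 𝓕.e + t⁻¹ • v ∈ interior (𝓕.C s) := by
    refine interior_maximal h Metric.isOpen_ball ?_
    rw [Metric.mem_ball, dist_eq_norm, add_sub_cancel_left, norm_smul, Real.norm_eq_abs,
      abs_of_pos (inv_pos.2 ht)]
    rw [inv_mul_lt_iff₀ ht]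
    exact hv
  have h2 := 𝓕.smul_mem_interior hs h1 ht
  rwa [smul_add, smul_inv_smul₀ ht.ne'] at h2

lemma inward (s : ℝ) (hs : s ∈ Ioo (0 : ℝ) 1) (X : V) (hX : X ∈ 𝓕.C s) (hX0 : X ≠ 0) :
    ∃ σ > (0 : ℝ), X + σ • 𝓕.Q X ∈ interior (𝓕.C s) := by
  have hs' : s ∈ Ico (0 : ℝ) 1 := ⟨hs.1.le, hs.2⟩
  obtain ⟨r, hr, hball⟩ := Metric.mem_nhds_iff.1 (mem_interior_iff_mem_nhds.1 (𝓕.e_mem s hs'))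
  obtain ⟨δ, hδ, h⟩ := 𝓕.tangent s hs X hX hX0
  set d := δ / (‖𝓕.e‖ + 1) with hd
  have hd0 : 0 < d := by positivity
  have hde : ‖𝓕.Q X - d • 𝓕.e - 𝓕.Q X‖ < δ := by
    rw [sub_sub_cancel_left, norm_neg, norm_smul, Real.norm_eq_abs, abs_of_pos hd0, hd,
      div_mul_eq_mul_div, div_lt_iff₀ (by positivity)]
    linarith
  obtain ⟨S, hS, t, ht, hlt⟩ := h _ hde (d * r) (mul_pos hd0 hr)
  have h1 := 𝓕.smul_mem_interior hs' (𝓕.smul_e_add_mem_interior hs' hr hball hlt)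
    (t := (1 + t)⁻¹) (by positivity)
  have h2 : (1 + t)⁻¹ • X + (t * (1 + t)⁻¹) • S ∈ 𝓕.C s :=
    𝓕.add_mem hs' (𝓕.smul_mem s hs' X hX _ (by positivity))
      (𝓕.smul_mem s hs' S hS _ (by positivity))
  refine ⟨(1 + t)⁻¹, by positivity, ?_⟩
  convert 𝓕.add_mem_interior hs' h2 h1 using 1
  have h3 : X = (1 + t)⁻¹ • X + (t * (1 + t)⁻¹) • X := by
    rw [← add_smul, ← one_add_mul, mul_inv_cancel₀ (by positivity), one_smul]
  nth_rewrite 1 [h3]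
  module

/-- The ball around `e` contained in `C s` can be chosen locally uniformly in `s`. -/
lemma eventually_ball_subset {s₀ : ℝ} (hs₀ : s₀ ∈ Ico (0 : ℝ) 1) :
    ∃ r > (0 : ℝ), ∀ᶠ s in 𝓝[Ico (0 : ℝ) 1] s₀, Metric.ball 𝓕.e r ⊆ 𝓕.C s := by
  obtain ⟨ρ, hρ, hball⟩ := Metric.mem_nhds_iff.1 (mem_interior_iff_mem_nhds.1 (𝓕.e_mem s₀ hs₀))
  set L := ‖𝓕.e‖ + ρ with hL
  have hLpos : 0 < L := by positivity
  refine ⟨ρ / 2, half_pos hρ, ?_⟩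
  filter_upwards [𝓕.hausdorff s₀ hs₀ (ρ / (4 * L)) (by positivity), self_mem_nhdsWithin]
    with s hs hsI X hX
  by_contra hXC
  obtain ⟨f, u, hfX, hfC⟩ :=
    geometric_hahn_banach_point_closed (𝓕.convex s hsI) (𝓕.closed s hsI) hXC
  have key : ∀ v : V, ‖v‖ = 1 → f v ≤ ‖f‖ / 2 := by
    intro v hv
    set Y := X - (ρ / 2) • v with hY
    have hXe : ‖X - 𝓕.e‖ < ρ / 2 := by simpa [dist_eq_norm] using hX
    have hve : ‖(ρ / 2) • v‖ = ρ / 2 := by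
      rw [norm_smul, hv, mul_one, Real.norm_eq_abs, abs_of_pos (half_pos hρ)]
    have hYe : ‖Y - 𝓕.e‖ < ρ := by
      have : Y - 𝓕.e = (X - 𝓕.e) - (ρ / 2) • v := by rw [hY]; abel
      rw [this]
      linarith [norm_sub_le (X - 𝓕.e) ((ρ / 2) • v)]
    have hYC : Y ∈ 𝓕.C s₀ := hball (by simpa [dist_eq_norm] using hYe)
    have hYL : ‖Y‖ ≤ L := by
      have := norm_add_le (Y - 𝓕.e) 𝓕.e
      rw [sub_add_cancel] at this
      linarith
    obtain ⟨Z, hZ, hYZ⟩ := hs.2 (L⁻¹ • Y) (𝓕.smul_mem s₀ hs₀ _ hYC _ (by positivity)) (by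
      rw [norm_smul, Real.norm_eq_abs, abs_of_pos (inv_pos.2 hLpos), inv_mul_le_iff₀ hLpos]
      linarith)
    have h1 := hfC _ (𝓕.smul_mem s hsI Z hZ L hLpos.le)
    have h2 : ‖Y - L • Z‖ ≤ ρ / 4 := by
      have : Y - L • Z = L • (L⁻¹ • Y - Z) := by rw [smul_sub, smul_inv_smul₀ hLpos.ne']
      rw [this, norm_smul, Real.norm_eq_abs, abs_of_pos hLpos]
      calc L * ‖L⁻¹ • Y - Z‖ ≤ L * (ρ / (4 * L)) := by gcongr
        _ = ρ / 4 := by field_simp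
    have h3 : f (L • Z) - f Y ≤ ‖f‖ * (ρ / 4) := by
      rw [← map_sub]
      refine (le_abs_self _).trans ((f.le_opNorm _).trans ?_)
      rw [norm_sub_rev]
      gcongr
    have h4 : f Y = f X - ρ / 2 * f v := by simp [hY]
    nlinarith
  have hf : ‖f‖ ≤ ‖f‖ / 2 := by
    refine ContinuousLinearMap.opNorm_le_of_unit_norm (by positivity) fun v hv => ?_
    have h1 := key v hv
    have h2 := key (-v) (by rwa [norm_neg])
    rw [map_neg] at h2
    exact abs_le.2 ⟨by linarith, h1⟩
  have hf0 : f = 0 := norm_le_zero_iff.1 (by linarith)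
  have := hfC 0 (𝓕.zero_mem hsI)
  simp [hf0] at this hfX
  linarith

/-- Nearby cones are contained in each other up to a small multiple of `e`. -/
lemma eventually_add_mem {s₀ : ℝ} (hs₀ : s₀ ∈ Ico (0 : ℝ) 1) {κ : ℝ} (hκ : 0 < κ) :
    ∀ᶠ s in 𝓝[Ico (0 : ℝ) 1] s₀, (∀ X ∈ 𝓕.C s, X + (κ * ‖X‖) • 𝓕.e ∈ 𝓕.C s₀) ∧
      ∀ X ∈ 𝓕.C s₀, X + (κ * ‖X‖) • 𝓕.e ∈ 𝓕.C s := by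
  obtain ⟨r, hr, hrs⟩ := 𝓕.eventually_ball_subset hs₀
  have main : ∀ s ∈ Ico (0 : ℝ) 1, ∀ s' ∈ Ico (0 : ℝ) 1, Metric.ball 𝓕.e r ⊆ 𝓕.C s' →
      (∀ X ∈ 𝓕.C s, ‖X‖ ≤ 1 → ∃ Y ∈ 𝓕.C s', ‖X - Y‖ ≤ κ * r / 2) →
      ∀ X ∈ 𝓕.C s, X + (κ * ‖X‖) • 𝓕.e ∈ 𝓕.C s' := by
    intro s hs s' hs' hb h X hX
    rcases eq_or_ne X 0 with rfl | hX0
    · simpa using 𝓕.zero_mem hs'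
    have hXn : 0 < ‖X‖ := norm_pos_iff.2 hX0
    obtain ⟨Y, hY, hXY⟩ := h (‖X‖⁻¹ • X) (𝓕.smul_mem s hs X hX _ (by positivity))
      (by rw [norm_smul, norm_inv, norm_norm, inv_mul_cancel₀ hXn.ne'])
    have h1 : κ • 𝓕.e + (‖X‖⁻¹ • X - Y) ∈ 𝓕.C s' :=
      interior_subset (𝓕.smul_e_add_mem_interior hs' hr hb
        (hXY.trans_lt (by have := mul_pos hκ hr; linarith)))
    have h2 := 𝓕.smul_mem s' hs' _ (𝓕.add_mem hs' hY h1) ‖X‖ hXn.le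
    have h3 : X = ‖X‖ • ‖X‖⁻¹ • X := (smul_inv_smul₀ hXn.ne' X).symm
    convert h2 using 1
    nth_rewrite 1 [h3]
    module
  filter_upwards [hrs, 𝓕.hausdorff s₀ hs₀ (κ * r / 2) (by positivity), self_mem_nhdsWithin]
    with s hb hh hs
  exact ⟨main s hs s₀ hs₀ (hrs.self_of_nhdsWithin hs₀) hh.1, main s₀ hs₀ s hs hb hh.2⟩

lemma Q_zero : 𝓕.Q 0 = 0 := by simpa using 𝓕.Q_smul 0 0

lemma norm_Q_le (X : V) : ‖𝓕.Q X‖ ≤ 𝓕.M * ‖X‖ ^ 2 := by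
  have := 𝓕.lipschitz X 0
  simp only [𝓕.Q_zero, sub_zero, norm_zero, add_zero] at this
  linarith [this, sq ‖X‖, mul_assoc 𝓕.M ‖X‖ ‖X‖]

lemma continuous_Q : Continuous 𝓕.Q := by
  refine continuous_iff_continuousAt.2 fun X => ?_
  rw [ContinuousAt, tendsto_iff_norm_sub_tendsto_zero]
  refine squeeze_zero (fun _ => norm_nonneg _) (fun Y => 𝓕.lipschitz Y X) ?_
  have : Continuous fun Y => 𝓕.M * ‖Y - X‖ * (‖Y‖ + ‖X‖) := by fun_prop
  simpa using this.tendsto X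

/-- For `X` in the cone, the points of the half-open segment towards a point of the cone. -/
lemma add_smul_mem_of_le (hs : s ∈ Ico (0 : ℝ) 1) {X v : V} {σ τ : ℝ} (hX : X ∈ 𝓕.C s)
    (h : X + τ • v ∈ 𝓕.C s) (hτ : 0 < τ) (hσ : 0 ≤ σ) (hστ : σ ≤ τ) : X + σ • v ∈ 𝓕.C s := by
  have h1 := 𝓕.convex s hs hX h (a := 1 - σ / τ) (b := σ / τ)
    (sub_nonneg.2 ((div_le_one hτ).2 hστ)) (by positivity) (by ring)
  convert h1 using 1
  have : σ • v = (σ / τ * τ) • v := by rw [div_mul_cancel₀ _ hτ.ne']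
  rw [this]
  module

/-- The depth with which `Q` points into the cones is locally uniform in `s`. -/
lemma eventually_inward [ProperSpace V] {s₀ : ℝ} (hs₀ : s₀ ∈ Ioo (0 : ℝ) 1) :
    ∃ c > (0 : ℝ), ∃ τ > (0 : ℝ), ∀ᶠ s in 𝓝[Ico (0 : ℝ) 1] s₀, ∀ X ∈ 𝓕.C s, ‖X‖ = 1 →
      X + τ • (𝓕.Q X - c • 𝓕.e) ∈ 𝓕.C s := by
  have hs₀' : s₀ ∈ Ico (0 : ℝ) 1 := ⟨hs₀.1.le, hs₀.2⟩
  suffices h : ∃ c > (0 : ℝ), ∃ τ > (0 : ℝ), ∀ᶠ s in 𝓝[Ico (0 : ℝ) 1] s₀,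
      ∀ X ∈ Metric.sphere (0 : V) 1, X ∈ 𝓕.C s → X + τ • (𝓕.Q X - c • 𝓕.e) ∈ 𝓕.C s by
    obtain ⟨c, hc, τ, hτ, h⟩ := h
    exact ⟨c, hc, τ, hτ, h.mono fun s h X hX hX1 => h X (by simpa using hX1) hX⟩
  have mono : ∀ s ∈ Ico (0 : ℝ) 1, ∀ X ∈ 𝓕.C s, ∀ c c' τ τ' : ℝ, c' ≤ c → 0 < τ' → τ' ≤ τ →
      X + τ • (𝓕.Q X - c • 𝓕.e) ∈ 𝓕.C s → X + τ' • (𝓕.Q X - c' • 𝓕.e) ∈ 𝓕.C s := by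
    intro s hs X hX c c' τ τ' hc hτ' hττ h
    have h1 := 𝓕.add_smul_e_mem hs (𝓕.add_smul_mem_of_le hs hX h (hτ'.trans_le hττ) hτ'.le hττ)
      (t := τ' * (c - c')) (mul_nonneg hτ'.le (sub_nonneg.2 hc))
    convert h1 using 1
    module
  refine (isCompact_sphere (0 : V) 1).induction_on
    (p := fun S => ∃ c > (0 : ℝ), ∃ τ > (0 : ℝ), ∀ᶠ s in 𝓝[Ico (0 : ℝ) 1] s₀, ∀ X ∈ S,
      X ∈ 𝓕.C s → X + τ • (𝓕.Q X - c • 𝓕.e) ∈ 𝓕.C s) ?_ ?_ ?_ ?_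
  · exact ⟨1, one_pos, 1, one_pos, by simp⟩
  · rintro S S' hS ⟨c, hc, τ, hτ, h⟩
    exact ⟨c, hc, τ, hτ, h.mono fun s h X hX => h X (hS hX)⟩
  · rintro S S' ⟨c, hc, τ, hτ, h⟩ ⟨c', hc', τ', hτ', h'⟩
    refine ⟨min c c', lt_min hc hc', min τ τ', lt_min hτ hτ', ?_⟩
    filter_upwards [h, h', self_mem_nhdsWithin] with s h h' hs X hX hXC
    rcases hX with hX | hX
    · exact mono s hs X hXC _ _ _ _ (min_le_left _ _) (lt_min hτ hτ') (min_le_left _ _)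
        (h X hX hXC)
    · exact mono s hs X hXC _ _ _ _ (min_le_right _ _) (lt_min hτ hτ') (min_le_right _ _)
        (h' X hX hXC)
  intro P hP
  by_cases hPC : P ∈ 𝓕.C s₀
  · have hP0 : P ≠ 0 := by
      rintro rfl
      simp at hP
    obtain ⟨τ, hτ, hin⟩ := 𝓕.inward s₀ hs₀ P hPC hP0
    have hev1 : ∀ᶠ c in 𝓝[>] (0 : ℝ), P + τ • (𝓕.Q P - (2 * c) • 𝓕.e) ∈ interior (𝓕.C s₀) := by
      have hcts : Continuous fun c : ℝ => P + τ • (𝓕.Q P - (2 * c) • 𝓕.e) := by fun_prop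
      refine nhdsWithin_le_nhds (hcts.continuousAt.eventually_mem
        (isOpen_interior.mem_nhds ?_))
      simpa using hin
    obtain ⟨c, hc, hc0⟩ := (hev1.and self_mem_nhdsWithin).exists
    have hc0 : 0 < c := hc0
    set W : V → V := fun X => X + τ • (𝓕.Q X - (2 * c) • 𝓕.e) with hW
    have hWc : Continuous W := by
      have := 𝓕.continuous_Q
      fun_prop
    set B := ‖W P‖ + 1 with hB
    have hBpos : 0 < B := by positivity
    have hN : ∀ᶠ X in 𝓝 P, W X ∈ interior (𝓕.C s₀) ∧ ‖W X‖ < B :=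
      (hWc.continuousAt.eventually_mem (isOpen_interior.mem_nhds hc)).and
        (hWc.norm.continuousAt.eventually_lt continuousAt_const (by simp [hB]))
    refine ⟨_, nhdsWithin_le_nhds hN, c, hc0, τ, hτ, ?_⟩
    filter_upwards [𝓕.eventually_add_mem hs₀' (κ := τ * c / B) (by positivity),
      self_mem_nhdsWithin] with s h hs X hX hXC
    have h1 := h.2 _ (interior_subset hX.1)
    have h2 : τ * c / B * ‖W X‖ ≤ τ * c := by
      rw [div_mul_eq_mul_div, div_le_iff₀ hBpos]
      have := hX.2.le
      gcongr
    have h3 := 𝓕.add_smul_e_mem hs h1 (t := τ * c - τ * c / B * ‖W X‖) (sub_nonneg.2 h2)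
    convert h3 using 1
    simp only [hW]
    module
  · obtain ⟨d, hd, hball⟩ := Metric.mem_nhds_iff.1 ((𝓕.closed s₀ hs₀').isOpen_compl.mem_nhds hPC)
    refine ⟨_, nhdsWithin_le_nhds (inter_mem (Metric.ball_mem_nhds P (half_pos hd))
      (Metric.ball_mem_nhds P one_pos)), 1, one_pos, 1, one_pos, ?_⟩
    filter_upwards [𝓕.eventually_add_mem hs₀' (κ := d / (4 * (‖𝓕.e‖ + 1))) (by positivity)]
      with s h X hX hXC
    exfalso
    refine hball ?_ (h.1 X hXC)
    have hX1 : ‖X - P‖ < d / 2 := by simpa [dist_eq_norm] using hX.1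
    have hX2 : ‖X - P‖ < 1 := by simpa [dist_eq_norm] using hX.2
    have hX3 : ‖X‖ ≤ 2 := by
      have := norm_add_le (X - P) P
      rw [sub_add_cancel, show ‖P‖ = 1 by simpa using hP] at this
      linarith
    rw [Metric.mem_ball, dist_eq_norm, add_sub_right_comm]
    refine (norm_add_le _ _).trans_lt ?_
    rw [norm_smul, Real.norm_eq_abs, abs_of_nonneg (by positivity)]
    have : d / (4 * (‖𝓕.e‖ + 1)) * ‖X‖ * ‖𝓕.e‖ ≤ d / 2 := by
      rw [div_mul_eq_mul_div, div_mul_eq_mul_div, div_le_iff₀ (by positivity)]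
      have : ‖X‖ * ‖𝓕.e‖ ≤ 2 * (‖𝓕.e‖ + 1) := by
        gcongr
        linarith
      nlinarith
    linarith

/-- A curve in the cone whose velocity points into the interior stays in it for a short time. -/
lemma eventually_mem_of_hasDerivWithinAt (hs : s ∈ Ico (0 : ℝ) 1) {P : ℝ → V} {v : V} {t : ℝ}
    (hP : HasDerivWithinAt P v (Ioi t) t) (hPt : P t ∈ 𝓕.C s)
    (hv : ∃ σ > (0 : ℝ), P t + σ • v ∈ interior (𝓕.C s)) : ∀ᶠ u in 𝓝[>] t, P u ∈ 𝓕.C s := by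
  obtain ⟨σ, hσ, hv⟩ := hv
  rw [hasDerivWithinAt_iff_tendsto_slope' self_notMem_Ioi] at hP
  have h1 : Tendsto (fun u => P t + σ • slope P t u) (𝓝[>] t) (𝓝 (P t + σ • v)) :=
    (hP.const_smul σ).const_add _
  filter_upwards [h1.eventually_mem (isOpen_interior.mem_nhds hv), self_mem_nhdsWithin,
    Ioo_mem_nhdsGT (show t < t + σ by linarith)] with u hu hut huσ
  have h2 := 𝓕.add_smul_mem_of_le hs hPt (interior_subset hu) hσ
    (sub_nonneg.2 (le_of_lt hut)) (sub_le_iff_le_add'.2 huσ.2.le)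
  have h3 := sub_smul_slope P t u
  rw [h3] at h2
  simpa using h2

end PinchingFamily

lemma mem_of_eventually_mem {X : Type*} [TopologicalSpace X] {S : Set X} (hS : IsClosed S)
    {T : ℝ} {P : ℝ → X} (hP : ContinuousOn P (Ico 0 T)) (h0 : P 0 ∈ S)
    (h : ∀ t ∈ Ico (0 : ℝ) T, P t ∈ S → ∀ᶠ u in 𝓝[>] t, P u ∈ S) :
    ∀ t ∈ Ico (0 : ℝ) T, P t ∈ S := by
  intro t ht
  have hsub : Icc 0 t ⊆ Ico 0 T := Icc_subset_Ico_right ht.2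
  have hcl : IsClosed (P ⁻¹' S ∩ Icc 0 t) := by
    rw [inter_comm]
    exact (hP.mono hsub).preimage_isClosed_of_isClosed isClosed_Icc hS
  exact hcl.Icc_subset_of_forall_mem_nhdsWithin h0
    (fun x hx => h x (hsub (Ico_subset_Icc_self hx.2)) hx.1) ⟨ht.1, le_rfl⟩

lemma HasDerivWithinAt.Ioi_of_Ico {V : Type*} [NormedAddCommGroup V] [NormedSpace ℝ V]
    {P : ℝ → V} {v : V} {T t : ℝ} (ht : t ∈ Ico (0 : ℝ) T)
    (h : HasDerivWithinAt P v (Ico 0 T) t) : HasDerivWithinAt P v (Ioi t) t :=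
  h.mono_of_mem_nhdsWithin (mem_of_superset (Ioo_mem_nhdsGT ht.2)
    fun _ hu => ⟨ht.1.trans hu.1.le, hu.2⟩)

namespace PinchingFamily

variable {V : Type*} [NormedAddCommGroup V] [NormedSpace ℝ V] (𝓕 : PinchingFamily V)
  {s : ℝ}

/-- Solutions that reach zero remain zero. -/
lemma eventually_eq_zero {T : ℝ} {R : ℝ → V}
    (hR : ∀ t ∈ Ico (0 : ℝ) T, HasDerivWithinAt R (𝓕.Q (R t)) (Ico (0 : ℝ) T) t)
    {t : ℝ} (ht : t ∈ Ico (0 : ℝ) T) (h0 : R t = 0) : ∀ᶠ u in 𝓝[>] t, R u = 0 := by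
  have hcont : ContinuousOn R (Ico 0 T) := fun x hx => (hR x hx).continuousWithinAt
  have hIci : Ico 0 T ∈ 𝓝[≥] t :=
    mem_of_superset (Ico_mem_nhdsGE ht.2) (Ico_subset_Ico_left ht.1)
  have hlt : ∀ᶠ u in 𝓝[≥] t, ‖R u‖ < 1 :=
    (((hcont t ht).mono_of_mem_nhdsWithin hIci).norm.eventually_lt
      continuousWithinAt_const (by simp [h0]))
  obtain ⟨b, hb, hbs⟩ := (mem_nhdsGE_iff_exists_Icc_subset).1 (inter_mem hIci hlt)
  have hb : t < b := hb
  have key := norm_le_gronwallBound_of_norm_deriv_right_le (f := R) (f' := fun u => 𝓕.Q (R u))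
    (δ := 0) (K := 𝓕.M) (ε := 0) (a := t) (b := b) (hcont.mono fun u hu => (hbs hu).1) ?_
    (by simp [h0]) ?_
  · filter_upwards [Ioo_mem_nhdsGT hb] with u hu
    have := key u (Ioo_subset_Icc_self hu)
    rw [gronwallBound_ε0_δ0] at this
    exact norm_le_zero_iff.1 this
  · intro u hu
    have hu' := (hbs (Ico_subset_Icc_self hu)).1
    exact (HasDerivWithinAt.Ioi_of_Ico hu' (hR u hu')).Ici_of_Ioi
  · intro u hu
    have h1 : ‖R u‖ < 1 := (hbs (Ico_subset_Icc_self hu)).2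
    rw [add_zero]
    refine (𝓕.norm_Q_le _).trans (mul_le_mul_of_nonneg_left ?_ 𝓕.M_nonneg)
    nlinarith [norm_nonneg (R u)]

lemma odeInvariant_C (hs : s ∈ Ioo (0 : ℝ) 1) : ODEInvariant 𝓕.Q (𝓕.C s) := by
  have hs' : s ∈ Ico (0 : ℝ) 1 := ⟨hs.1.le, hs.2⟩
  intro T R hR h0
  refine mem_of_eventually_mem (𝓕.closed s hs') (fun x hx => (hR x hx).continuousWithinAt) h0 ?_
  intro t ht htC
  by_cases hz : R t = 0
  · exact (𝓕.eventually_eq_zero hR ht hz).mono fun u hu => hu ▸ 𝓕.zero_mem hs'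
  · exact 𝓕.eventually_mem_of_hasDerivWithinAt hs' (HasDerivWithinAt.Ioi_of_Ico ht (hR t ht)) htC
      (𝓕.inward s hs _ htC hz)

/-- The closed convex symmetric sets in `C ε` which are invariant under the differential
equation and contain `C ε ∩ {ℓ ≤ h₀}`. -/
structure IsGood (ε h₀ : ℝ) (S : Set V) : Prop where
  isClosed : IsClosed S
  convex : Convex ℝ S
  symm : ∀ g ∈ 𝓕.G, ∀ X ∈ S, g X ∈ S
  invariant : ODEInvariant 𝓕.Q S
  contains : {X ∈ 𝓕.C ε | 𝓕.ℓ X ≤ h₀} ⊆ S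
  subset : S ⊆ 𝓕.C ε

variable {𝓕} {ε h₀ : ℝ}

lemma isGood_C (hε : ε ∈ Ioo (0 : ℝ) 1) : 𝓕.IsGood ε h₀ (𝓕.C ε) where
  isClosed := 𝓕.closed ε ⟨hε.1.le, hε.2⟩
  convex := 𝓕.convex ε ⟨hε.1.le, hε.2⟩
  symm g hg := 𝓕.G_C g hg ε ⟨hε.1.le, hε.2⟩
  invariant := 𝓕.odeInvariant_C hε
  contains := fun _ h => h.1
  subset := subset_rfl

lemma isGood_sInter (hε : ε ∈ Ioo (0 : ℝ) 1) :
    𝓕.IsGood ε h₀ (⋂₀ {S | 𝓕.IsGood ε h₀ S}) where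
  isClosed := isClosed_sInter fun _ h => h.isClosed
  convex := convex_sInter fun _ h => h.convex
  symm g hg X hX := fun S hS => hS.symm g hg X (hX S hS)
  invariant T R hR h0 t ht := fun S hS => hS.invariant T R hR (h0 S hS) t ht
  contains := fun _ hX _ hS => hS.contains hX
  subset := sInter_subset_of_mem (isGood_C hε)

variable (𝓕)

lemma exists_norm_le [ProperSpace V] (hs : s ∈ Ico (0 : ℝ) 1) :
    ∃ κ > (0 : ℝ), ∀ X ∈ 𝓕.C s, ‖X‖ ≤ κ * 𝓕.ℓ X := by
  have hcomp : IsCompact (𝓕.C s ∩ Metric.sphere 0 1) :=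
    (isCompact_sphere (0 : V) 1).inter_left (𝓕.closed s hs)
  obtain ⟨m, hm, hle⟩ : ∃ m > (0 : ℝ), ∀ X ∈ 𝓕.C s ∩ Metric.sphere 0 1, m ≤ 𝓕.ℓ X := by
    rcases (𝓕.C s ∩ Metric.sphere 0 1).eq_empty_or_nonempty with h | h
    · exact ⟨1, one_pos, by simp [h]⟩
    · obtain ⟨Y, hY, hmin⟩ := hcomp.exists_isMinOn h 𝓕.ℓ.continuous.continuousOn
      refine ⟨𝓕.ℓ Y, 𝓕.pos s hs Y hY.1 ?_, fun X hX => hmin hX⟩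
      rintro rfl
      simpa using hY.2
  refine ⟨m⁻¹, inv_pos.2 hm, fun X hX => ?_⟩
  rcases eq_or_ne X 0 with rfl | hX0
  · simp
  have hXn : 0 < ‖X‖ := norm_pos_iff.2 hX0
  have h1 := hle (‖X‖⁻¹ • X) ⟨𝓕.smul_mem s hs X hX _ (by positivity), by
    simp [norm_smul, hXn.ne']⟩
  rw [map_smul, smul_eq_mul, le_inv_mul_iff₀ hXn] at h1
  rw [le_inv_mul_iff₀ hm]
  linarith

/-- The convex set of all `X` such that `X + (a - η ℓ X) e` lies in `C s`. -/
def shifted (s a η : ℝ) : Set V := {X | X + (a - η * 𝓕.ℓ X) • 𝓕.e ∈ 𝓕.C s}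

lemma shifted_isClosed (hs : s ∈ Ico (0 : ℝ) 1) (a η : ℝ) : IsClosed (𝓕.shifted s a η) :=
  (𝓕.closed s hs).preimage (by fun_prop)

lemma shifted_convex (hs : s ∈ Ico (0 : ℝ) 1) (a η : ℝ) : Convex ℝ (𝓕.shifted s a η) := by
  intro X hX Y hY p q hp hq hpq
  have h := 𝓕.convex s hs hX hY hp hq hpq
  simp only [shifted, mem_ofPred_eq, map_add, map_smul, smul_eq_mul]
  convert h using 1
  have : a = p * a + q * a := by rw [← add_mul, hpq, one_mul]
  nth_rewrite 1 [this]
  module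

lemma shifted_symm (hs : s ∈ Ico (0 : ℝ) 1) (a η : ℝ) {g : V →ₗ[ℝ] V} (hg : g ∈ 𝓕.G) {X : V}
    (hX : X ∈ 𝓕.shifted s a η) : g X ∈ 𝓕.shifted s a η := by
  have h := 𝓕.G_C g hg s hs _ hX
  simpa [shifted, 𝓕.G_e g hg, 𝓕.G_ℓ g hg] using h

lemma shifted_contains (hs : s ∈ Ico (0 : ℝ) 1) {r B a η h₀ : ℝ} (hr : 0 < r)
    (hball : Metric.ball 𝓕.e r ⊆ 𝓕.C s) (hη : 0 ≤ η) (ha : B < (a - η * h₀) * r) {X : V}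
    (hX : ‖X‖ ≤ B) (hℓ : 𝓕.ℓ X ≤ h₀) : X ∈ 𝓕.shifted s a η := by
  have h : (a - η * 𝓕.ℓ X) • 𝓕.e + X ∈ interior (𝓕.C s) := by
    refine 𝓕.smul_e_add_mem_interior hs hr hball (hX.trans_lt (ha.trans_le ?_))
    gcongr
  rw [add_comm] at h
  exact interior_subset (s := 𝓕.C s) h

lemma shifted_subset (hs : s ∈ Ico (0 : ℝ) 1) {a η : ℝ} {X : V}
    (hX : X ∈ 𝓕.shifted s a η) (h : a ≤ η * 𝓕.ℓ X) : X ∈ 𝓕.C s := by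
  have := 𝓕.add_smul_e_mem hs hX (sub_nonneg.2 h)
  convert this using 1
  module

/-- A point of the shifted cone which is small compared to `a` is an interior one, provided that
it lies in an earlier shifted cone. -/
lemma shifted_interior_of_small (hs : s ∈ Ico (0 : ℝ) 1) {μ κ a a' η : ℝ} (hμ : 0 < μ)
    (hκ : 0 ≤ κ) (ha : 0 < a) (ha' : 0 ≤ a') (haa : 2 * a' ≤ a) (hη : 0 ≤ η)
    (hημ : η * ‖𝓕.ℓ‖ ≤ μ / 8) (hκμ : κ * (1 + μ * ‖𝓕.e‖) ≤ μ / 8) {X : V}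
    (hX : X + a' • 𝓕.e + (κ * ‖X + a' • 𝓕.e‖) • 𝓕.e ∈ 𝓕.C s) (hsmall : μ * ‖X‖ < a) :
    X + (a - η * 𝓕.ℓ X) • 𝓕.e ∈ interior (𝓕.C s) := by
  set Y := X + a' • 𝓕.e with hY
  have h1 : η * 𝓕.ℓ X ≤ a / 8 := by
    have h2 : 𝓕.ℓ X ≤ ‖𝓕.ℓ‖ * ‖X‖ := (le_abs_self _).trans (𝓕.ℓ.le_opNorm X)
    calc η * 𝓕.ℓ X ≤ η * (‖𝓕.ℓ‖ * ‖X‖) := by gcongr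
      _ = η * ‖𝓕.ℓ‖ * ‖X‖ := by ring
      _ ≤ μ / 8 * ‖X‖ := by gcongr
      _ ≤ a / 8 := by linarith
  have h3 : κ * ‖Y‖ ≤ a / 8 := by
    have h4 : ‖Y‖ ≤ ‖X‖ + a' * ‖𝓕.e‖ := by
      refine (norm_add_le _ _).trans ?_
      rw [norm_smul, Real.norm_eq_abs, abs_of_nonneg ha']
    have h5 : μ * ‖Y‖ ≤ a * (1 + μ * ‖𝓕.e‖) := by
      have h6 : a' * (μ * ‖𝓕.e‖) ≤ a * (μ * ‖𝓕.e‖) := by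
        gcongr
        linarith
      have := mul_le_mul_of_nonneg_left h4 hμ.le
      nlinarith
    have h7 : μ * (κ * ‖Y‖) ≤ μ * (a / 8) := by
      calc μ * (κ * ‖Y‖) = κ * (μ * ‖Y‖) := by ring
        _ ≤ κ * (a * (1 + μ * ‖𝓕.e‖)) := by gcongr
        _ = a * (κ * (1 + μ * ‖𝓕.e‖)) := by ring
        _ ≤ a * (μ / 8) := by gcongr
        _ = μ * (a / 8) := by ring
    exact le_of_mul_le_mul_left h7 hμ
  have h := 𝓕.add_mem_interior hs hX (𝓕.smul_mem_interior hs (𝓕.e_mem s hs)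
    (t := a - a' - η * 𝓕.ℓ X - κ * ‖Y‖) (by linarith))
  convert h using 1
  rw [hY]
  module

/-- At a point of the shifted cone which is large compared to `a`, the vector field points into
the interior. -/
lemma shifted_inward_of_large (hs : s ∈ Ico (0 : ℝ) 1) {r c τ μ a η : ℝ} (hr : 0 < r)
    (hτ : 0 < τ) (hball : Metric.ball 𝓕.e r ⊆ 𝓕.C s)
    (hdeep : ∀ X ∈ 𝓕.C s, ‖X‖ = 1 → X + τ • (𝓕.Q X - c • 𝓕.e) ∈ 𝓕.C s)
    (hμe : 2 * μ * ‖𝓕.e‖ ≤ 1 / 2) (hμM : 32 * 𝓕.M * μ * ‖𝓕.e‖ < c * r) (ha : 0 < a)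
    (hη : 0 ≤ η) (hημ : η * ‖𝓕.ℓ‖ ≤ μ / 8) {X : V} (hX : X ∈ 𝓕.shifted s a η)
    (hlarge : a ≤ μ * ‖X‖) :
    ∃ σ > (0 : ℝ), X + (a - η * 𝓕.ℓ X) • 𝓕.e +
      σ • (𝓕.Q X - (η * 𝓕.ℓ (𝓕.Q X)) • 𝓕.e) ∈ interior (𝓕.C s) := by
  have hM := 𝓕.M_nonneg
  have hXn : 0 < ‖X‖ := by
    rcases eq_or_ne X 0 with rfl | hX0
    · simp at hlarge; linarith
    · exact norm_pos_iff.2 hX0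
  have hμ : 0 < μ := pos_of_mul_pos_left (ha.trans_le hlarge) hXn.le
  set P := X + (a - η * 𝓕.ℓ X) • 𝓕.e with hP
  have hηℓ : ∀ Y, |η * 𝓕.ℓ Y| ≤ μ / 8 * ‖Y‖ := by
    intro Y
    rw [abs_mul, abs_of_nonneg hη]
    calc η * |𝓕.ℓ Y| ≤ η * (‖𝓕.ℓ‖ * ‖Y‖) := by
          gcongr
          exact 𝓕.ℓ.le_opNorm Y
      _ = η * ‖𝓕.ℓ‖ * ‖Y‖ := by ring
      _ ≤ μ / 8 * ‖Y‖ := by gcongr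
  set ω := 2 * μ * ‖𝓕.e‖ with hω
  have hω0 : 0 ≤ ω := by positivity
  have hPX : ‖X - P‖ ≤ ω * ‖X‖ := by
    have h1 : X - P = -((a - η * 𝓕.ℓ X) • 𝓕.e) := by rw [hP]; abel
    have h2 : |a - η * 𝓕.ℓ X| ≤ 2 * μ * ‖X‖ := by
      have h3 := abs_le.1 (hηℓ X)
      have h4 : 0 < μ * ‖X‖ := by positivity
      exact abs_le.2 ⟨by linarith, by linarith⟩
    rw [h1, norm_neg, norm_smul, Real.norm_eq_abs]
    calc |a - η * 𝓕.ℓ X| * ‖𝓕.e‖ ≤ 2 * μ * ‖X‖ * ‖𝓕.e‖ := by gcongr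
      _ = ω * ‖X‖ := by rw [hω]; ring
  have hXP : ‖X‖ ≤ 2 * ‖P‖ := by
    have h1 := norm_add_le (X - P) P
    rw [sub_add_cancel] at h1
    nlinarith
  have hPn : 0 < ‖P‖ := by linarith
  have hP3 : ‖P‖ ≤ 2 * ‖X‖ := by
    have h1 := norm_sub_le X (X - P)
    rw [sub_sub_cancel] at h1
    nlinarith
  set E := 𝓕.Q X - 𝓕.Q P - (η * 𝓕.ℓ (𝓕.Q X)) • 𝓕.e with hE
  have hEn : ‖E‖ < c * ‖P‖ ^ 2 * r := by
    have h1 : ‖𝓕.Q X - 𝓕.Q P‖ ≤ 3 * 𝓕.M * ω * ‖X‖ ^ 2 := by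
      calc ‖𝓕.Q X - 𝓕.Q P‖ ≤ 𝓕.M * ‖X - P‖ * (‖X‖ + ‖P‖) := 𝓕.lipschitz X P
        _ ≤ 𝓕.M * (ω * ‖X‖) * (‖X‖ + 2 * ‖X‖) := by gcongr
        _ = 3 * 𝓕.M * ω * ‖X‖ ^ 2 := by ring
    have h2 : ‖(η * 𝓕.ℓ (𝓕.Q X)) • 𝓕.e‖ ≤ 𝓕.M * ω * ‖X‖ ^ 2 := by
      rw [norm_smul, Real.norm_eq_abs]
      calc |η * 𝓕.ℓ (𝓕.Q X)| * ‖𝓕.e‖ ≤ μ / 8 * ‖𝓕.Q X‖ * ‖𝓕.e‖ := by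
            gcongr
            exact hηℓ _
        _ ≤ 2 * μ * (𝓕.M * ‖X‖ ^ 2) * ‖𝓕.e‖ := by
            gcongr
            · linarith
            · exact 𝓕.norm_Q_le X
        _ = 𝓕.M * ω * ‖X‖ ^ 2 := by rw [hω]; ring
    have h3 : ‖X‖ ^ 2 ≤ 4 * ‖P‖ ^ 2 := by nlinarith
    calc ‖E‖ ≤ 3 * 𝓕.M * ω * ‖X‖ ^ 2 + 𝓕.M * ω * ‖X‖ ^ 2 :=
          (norm_sub_le _ _).trans (add_le_add h1 h2)
      _ = 4 * 𝓕.M * ω * ‖X‖ ^ 2 := by ring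
      _ ≤ 4 * 𝓕.M * ω * (4 * ‖P‖ ^ 2) := by gcongr
      _ = 32 * 𝓕.M * μ * ‖𝓕.e‖ * ‖P‖ ^ 2 := by rw [hω]; ring
      _ < c * r * ‖P‖ ^ 2 := by gcongr
      _ = c * ‖P‖ ^ 2 * r := by ring
  have hmem := 𝓕.smul_mem s hs _ (hdeep (‖P‖⁻¹ • P) (𝓕.smul_mem s hs P hX _ (by positivity))
    (by rw [norm_smul, norm_inv, norm_norm, inv_mul_cancel₀ hPn.ne'])) ‖P‖ hPn.le
  refine ⟨τ / ‖P‖, by positivity, ?_⟩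
  have h := 𝓕.add_mem_interior hs hmem (𝓕.smul_mem_interior hs
    (𝓕.smul_e_add_mem_interior hs hr hball hEn) (t := τ / ‖P‖) (by positivity))
  convert h using 1
  rw [𝓕.Q_smul, hE, smul_add, smul_inv_smul₀ hPn.ne']
  match_scalars <;> field_simp <;> ring

/-- Intersecting a good set close to `C s'` with a shifted cone over `C s`, for `s'` near `s`. -/
lemma IsGood.exists_inter_shifted [ProperSpace V] {𝓕 : PinchingFamily V} {ε h₀ s : ℝ}
    (hε : ε ∈ Ioo (0 : ℝ) 1) (hh₀ : 0 < h₀) (hs : s ∈ Ico (0 : ℝ) 1) {r c τ μ κ η a' : ℝ}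
    {K : Set V}
    (hr : 0 < r) (hτ : 0 < τ) (hμ : 0 < μ) (hκ : 0 ≤ κ) (hη : 0 ≤ η)
    (hball : Metric.ball 𝓕.e r ⊆ 𝓕.C s)
    (hdeep : ∀ X ∈ 𝓕.C s, ‖X‖ = 1 → X + τ • (𝓕.Q X - c • 𝓕.e) ∈ 𝓕.C s)
    (hclose : ∀ X ∈ K, X + (κ * ‖X‖) • 𝓕.e ∈ 𝓕.C s)
    (hμe : 2 * μ * ‖𝓕.e‖ ≤ 1 / 2) (hμM : 32 * 𝓕.M * μ * ‖𝓕.e‖ < c * r)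
    (hημ : η * ‖𝓕.ℓ‖ ≤ μ / 8) (hκμ : κ * (1 + μ * ‖𝓕.e‖) ≤ μ / 8)
    {S : Set V} (hS : 𝓕.IsGood ε h₀ S) (ha' : 0 ≤ a') (hSK : ∀ X ∈ S, X + a' • 𝓕.e ∈ K) :
    ∃ a > (0 : ℝ), 𝓕.IsGood ε h₀ (S ∩ 𝓕.shifted s a η) := by
  have hε' : ε ∈ Ico (0 : ℝ) 1 := ⟨hε.1.le, hε.2⟩
  obtain ⟨N, hN, hbound⟩ := 𝓕.exists_norm_le hε'
  set a := 2 * a' + η * h₀ + N * h₀ / r + 1 with ha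
  have h1 : 0 ≤ η * h₀ := by positivity
  have h2 : 0 ≤ N * h₀ / r := by positivity
  have hapos : 0 < a := by positivity
  refine ⟨a, hapos, ?_⟩
  refine ⟨hS.isClosed.inter (𝓕.shifted_isClosed hs a η),
    hS.convex.inter (𝓕.shifted_convex hs a η),
    fun g hg X hX => ⟨hS.symm g hg X hX.1, 𝓕.shifted_symm hs a η hg hX.2⟩, ?_, ?_,
    inter_subset_left.trans hS.subset⟩
  · intro T R hR h0
    have hRS := hS.invariant T R hR h0.1
    have hcont : ContinuousOn R (Ico 0 T) := fun x hx => (hR x hx).continuousWithinAt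
    intro t ht
    refine ⟨hRS t ht, ?_⟩
    have hPcont : ContinuousOn (fun u => R u + (a - η * 𝓕.ℓ (R u)) • 𝓕.e) (Ico 0 T) := by
      have : Continuous fun X : V => X + (a - η * 𝓕.ℓ X) • 𝓕.e := by fun_prop
      exact this.comp_continuousOn hcont
    refine mem_of_eventually_mem (P := fun u => R u + (a - η * 𝓕.ℓ (R u)) • 𝓕.e)
      (𝓕.closed s hs) hPcont h0.2 (fun u hu huC => ?_) t ht
    rcases lt_or_ge (μ * ‖R u‖) a with hsmall | hlarge
    · have hint := 𝓕.shifted_interior_of_small hs hμ hκ hapos ha' (by linarith) hη hημ hκμ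
        (hclose _ (hSK _ (hRS u hu))) hsmall
      have hIoi : Ico 0 T ∈ 𝓝[>] u :=
        mem_of_superset (Ioo_mem_nhdsGT hu.2) fun v hv => ⟨hu.1.trans hv.1.le, hv.2⟩
      have hcu := (hPcont u hu).mono_of_mem_nhdsWithin hIoi
      exact (hcu.eventually_mem (isOpen_interior.mem_nhds hint)).mono fun v hv =>
        interior_subset hv
    · have hRd := HasDerivWithinAt.Ioi_of_Ico hu (hR u hu)
      have hℓd := 𝓕.ℓ.hasFDerivAt.comp_hasDerivWithinAt u hRd
      have hd := hRd.add (((hℓd.const_mul η).const_sub a).smul_const 𝓕.e)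
      refine 𝓕.eventually_mem_of_hasDerivWithinAt hs hd huC ?_
      obtain ⟨σ, hσ, h⟩ := 𝓕.shifted_inward_of_large hs hr hτ hball hdeep hμe hμM hapos hη hημ
        huC hlarge
      refine ⟨σ, hσ, ?_⟩
      convert h using 3
      rw [neg_smul, sub_eq_add_neg]
  · intro X hX
    refine ⟨hS.contains hX, 𝓕.shifted_contains hs hr hball hη (B := N * h₀) ?_ ?_ hX.2⟩
    · have : N * h₀ = N * h₀ / r * r := by field_simp
      rw [this]
      gcongr
      linarith
    · exact (hbound X hX.1).trans (by gcongr; exact hX.2)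

/-- The existence of a good set which lies in `C s` up to translation by a multiple of `e`. -/
def Near (ε h₀ s : ℝ) : Prop :=
  ∃ S, 𝓕.IsGood ε h₀ S ∧ ∃ a ≥ (0 : ℝ), ∀ X ∈ S, X + a • 𝓕.e ∈ 𝓕.C s

/-- The existence of a good set which lies in a slightly shrunk shifted cone over `C s`. -/
def Inside (ε h₀ s : ℝ) : Prop :=
  ∃ S, 𝓕.IsGood ε h₀ S ∧ ∃ a > (0 : ℝ), ∃ η > (0 : ℝ), S ⊆ 𝓕.shifted s a η

variable {𝓕} {ε h₀ : ℝ}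

lemma pos_of_mem (hs : s ∈ Ico (0 : ℝ) 1) {X : V} (hX : X ∈ 𝓕.C s) : 0 ≤ 𝓕.ℓ X := by
  rcases eq_or_ne X 0 with rfl | h
  · simp
  · exact (𝓕.pos s hs X hX h).le

lemma Inside.near (hε : ε ∈ Ioo (0 : ℝ) 1) (hs : s ∈ Ico (0 : ℝ) 1) (h : 𝓕.Inside ε h₀ s) :
    𝓕.Near ε h₀ s := by
  obtain ⟨S, hS, a, ha, η, hη, hSs⟩ := h
  refine ⟨S, hS, a, ha.le, fun X hX => ?_⟩
  have h1 := 𝓕.add_smul_e_mem hs (hSs hX) (t := η * 𝓕.ℓ X)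
    (mul_nonneg hη.le (pos_of_mem ⟨hε.1.le, hε.2⟩ (hS.subset hX)))
  convert h1 using 1
  module

lemma eventually_inside [ProperSpace V] (hε : ε ∈ Ioo (0 : ℝ) 1) (hh₀ : 0 < h₀)
    (hs : s ∈ Ioo (0 : ℝ) 1) : ∀ᶠ s' in 𝓝[Ico (0 : ℝ) 1] s,
      (𝓕.Near ε h₀ s → 𝓕.Inside ε h₀ s') ∧ (𝓕.Near ε h₀ s' → 𝓕.Inside ε h₀ s) := by
  have hs' : s ∈ Ico (0 : ℝ) 1 := ⟨hs.1.le, hs.2⟩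
  obtain ⟨r, hr, hball⟩ := 𝓕.eventually_ball_subset hs'
  obtain ⟨c, hc, τ, hτ, hdeep⟩ := 𝓕.eventually_inward hs
  have hM := 𝓕.M_nonneg
  obtain ⟨μ, hμ, hμe, hμM⟩ : ∃ μ > (0 : ℝ), 2 * μ * ‖𝓕.e‖ ≤ 1 / 2 ∧
      32 * 𝓕.M * μ * ‖𝓕.e‖ < c * r := by
    have h1 : ∀ᶠ μ in 𝓝[>] (0 : ℝ), 2 * μ * ‖𝓕.e‖ < 1 / 2 := by
      have : Continuous fun μ : ℝ => 2 * μ * ‖𝓕.e‖ := by fun_prop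
      exact nhdsWithin_le_nhds (this.continuousAt.eventually_lt continuousAt_const (by simp))
    have h2 : ∀ᶠ μ in 𝓝[>] (0 : ℝ), 32 * 𝓕.M * μ * ‖𝓕.e‖ < c * r := by
      have : Continuous fun μ : ℝ => 32 * 𝓕.M * μ * ‖𝓕.e‖ := by fun_prop
      exact nhdsWithin_le_nhds (this.continuousAt.eventually_lt continuousAt_const
        (by simpa using mul_pos hc hr))
    obtain ⟨μ, ⟨h1, h2⟩, hμ⟩ := ((h1.and h2).and self_mem_nhdsWithin).exists
    exact ⟨μ, hμ, h1.le, h2⟩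
  set η := μ / 8 / (‖𝓕.ℓ‖ + 1) with hηdef
  have hη : 0 < η := by positivity
  have hημ : η * ‖𝓕.ℓ‖ ≤ μ / 8 := by
    rw [hηdef, div_mul_eq_mul_div, div_le_iff₀ (by positivity)]
    gcongr
    linarith
  set κ := μ / 8 / (1 + μ * ‖𝓕.e‖) with hκdef
  have hκ : 0 < κ := by positivity
  have hκμ : κ * (1 + μ * ‖𝓕.e‖) ≤ μ / 8 := by
    rw [hκdef, div_mul_cancel₀ _ (by positivity)]
  filter_upwards [hball, hdeep, 𝓕.eventually_add_mem hs' hκ, self_mem_nhdsWithin]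
    with s' hb hd hcl hsI
  refine ⟨fun ⟨S, hS, a', ha', h⟩ => ?_, fun ⟨S, hS, a', ha', h⟩ => ?_⟩
  · obtain ⟨a, ha, hg⟩ := hS.exists_inter_shifted hε hh₀ hsI hr hτ hμ hκ.le hη.le hb hd hcl.2
      hμe hμM hημ hκμ ha' h
    exact ⟨_, hg, a, ha, η, hη, inter_subset_right⟩
  · obtain ⟨a, ha, hg⟩ := hS.exists_inter_shifted hε hh₀ hs' hr hτ hμ hκ.le hη.le
      (hball.self_of_nhdsWithin hs') (hdeep.self_of_nhdsWithin hs') hcl.1 hμe hμM hημ hκμ ha' h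
    exact ⟨_, hg, a, ha, η, hη, inter_subset_right⟩

lemma inside [ProperSpace V] (hε : ε ∈ Ioo (0 : ℝ) 1) (hh₀ : 0 < h₀) (hs : s ∈ Ico ε 1) :
    𝓕.Inside ε h₀ s := by
  have hsub : Ico ε 1 ⊆ Ico (0 : ℝ) 1 := Ico_subset_Ico_left hε.1.le
  have hIoo : ∀ {x}, x ∈ Ico ε 1 → x ∈ Ioo (0 : ℝ) 1 := fun hx => ⟨hε.1.trans_le hx.1, hx.2⟩
  have hiff : 𝓕.Near ε h₀ ε ↔ 𝓕.Near ε h₀ s := by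
    refine (isPreconnected_Ico (a := ε) (b := 1)).induction₂
      (fun x y => 𝓕.Near ε h₀ x ↔ 𝓕.Near ε h₀ y) (fun x hx => ?_)
      (fun x y z _ _ _ => Iff.trans) (fun x y _ _ => Iff.symm) ⟨le_rfl, hε.2⟩ hs
    filter_upwards [nhdsWithin_mono x hsub (eventually_inside (𝓕 := 𝓕) hε hh₀ (hIoo hx)),
      self_mem_nhdsWithin] with y hy hyI
    exact ⟨fun h => (hy.1 h).near hε (hsub hyI), fun h => (hy.2 h).near hε (hsub hx)⟩
  have hnear : 𝓕.Near ε h₀ s := hiff.1 ⟨𝓕.C ε, isGood_C hε, 0, le_rfl, fun X hX => by simpa⟩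
  exact ((eventually_inside (𝓕 := 𝓕) hε hh₀ (hIoo hs)).self_of_nhdsWithin (hsub hs)).1 hnear

/-- Existence of generalized pinching sets. -/
theorem exists_pinchingSet [ProperSpace V] (hε : ε ∈ Ioo (0 : ℝ) 1) (hh₀ : 0 < h₀) :
    ∃ S, 𝓕.IsGood ε h₀ S ∧ ∀ s ∈ Ico ε 1, ∃ b : ℝ, ∀ X ∈ S \ 𝓕.C s, ‖X‖ ≤ b := by
  refine ⟨_, isGood_sInter hε, fun s hs => ?_⟩
  obtain ⟨S, hS, a, ha, η, hη, hSs⟩ := inside (𝓕 := 𝓕) hε hh₀ hs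
  obtain ⟨N, hN, hbound⟩ := 𝓕.exists_norm_le ⟨hε.1.le, hε.2⟩
  refine ⟨N * (a / η), fun X ⟨hX, hXC⟩ => ?_⟩
  have hXS := hX S hS
  refine (hbound X (hS.subset hXS)).trans ?_
  gcongr
  rw [le_div_iff₀ hη]
  by_contra! hlt
  exact hXC (𝓕.shifted_subset ⟨hε.1.le.trans hs.1, hs.2⟩ (hSs hXS) (by linarith))

end PinchingFamily

end Abstract

section CurvatureOperators

/-! ### The inner product, the coordinates and the trace -/

lemma so_apply_swap (X : so n) (i j : Fin n) : (X : Mat n) j i = -(X : Mat n) i j :=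
  congrFun (congrFun (mem_so_iff.1 X.2) i) j

lemma ip_eq_sum (A B : so n) : ip A B = 1 / 2 * ∑ i, ∑ j, (A : Mat n) i j * (B : Mat n) i j := by
  have h : ∀ i, ∑ j, (A : Mat n) i j * (B : Mat n) j i =
      -∑ j, (A : Mat n) i j * (B : Mat n) i j := fun i => by
    rw [← Finset.sum_neg_distrib]
    exact Finset.sum_congr rfl fun j _ => by rw [so_apply_swap B i j, mul_neg]
  simp only [ip, Matrix.trace, Matrix.diag, Matrix.mul_apply, h, Finset.sum_neg_distrib]
  ring

lemma ip_comm (A B : so n) : ip A B = ip B A := by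
  simp only [ip_eq_sum, mul_comm]

lemma ipL_apply (A B : so n) : ipL A B = ip A B := rfl

lemma ip_add_left (A B X : so n) : ip (A + B) X = ip A X + ip B X := by
  rw [ip_comm, ip_comm A, ip_comm B]
  exact (ipL X).map_add A B

lemma ip_smul_left (c : ℝ) (A X : so n) : ip (c • A) X = c * ip A X := by
  rw [ip_comm, ip_comm A]
  exact (ipL X).map_smul c A

lemma ip_add_right (X A B : so n) : ip X (A + B) = ip X A + ip X B := (ipL X).map_add A B

lemma ip_smul_right (c : ℝ) (X A : so n) : ip X (c • A) = c * ip X A := (ipL X).map_smul c A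

lemma bvec_apply (i j k l : Fin n) : (bvec i j : Mat n) k l =
    (if k = i then 1 else 0) * (if l = j then 1 else 0) -
      (if k = j then 1 else 0) * (if l = i then 1 else 0) := rfl

lemma bvec_swap (i j : Fin n) : bvec j i = -bvec i j := by
  ext k l
  rw [Submodule.coe_neg, Matrix.neg_apply, bvec_apply, bvec_apply]
  ring

lemma ip_bvec (X : so n) (i j : Fin n) : ip X (bvec i j) = (X : Mat n) i j := by
  rw [ip_eq_sum]
  simp [bvec_apply, mul_sub, Finset.sum_sub_distrib, so_apply_swap X i j]
  ring

/-- A sum over pairs `i < j` of a symmetric function vanishing on the diagonal. -/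
lemma sum_pairs {E : Type*} [AddCommGroup E] [Module ℝ E] (f : Fin n → Fin n → E)
    (hsymm : ∀ i j, f j i = f i j)
    (hdiag : ∀ i, f i i = 0) : ∑ p ∈ pairs n, f p.1 p.2 = (1 / 2 : ℝ) • ∑ i, ∑ j, f i j := by
  have h1 : ∀ i j, f i j = (if i < j then f i j else 0) + (if j < i then f j i else 0) := by
    intro i j
    rcases lt_trichotomy i j with h | rfl | h
    · simp [h, h.le]
    · simp [hdiag]
    · simp [h, h.le, hsymm]
  have h2 : ∑ p ∈ pairs n, f p.1 p.2 = ∑ i, ∑ j, if i < j then f i j else 0 := by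
    rw [pairs, Finset.sum_filter, Fintype.sum_prod_type]
  have h3 : ∑ i, ∑ j, f i j = ∑ p ∈ pairs n, f p.1 p.2 + ∑ p ∈ pairs n, f p.1 p.2 := by
    rw [h2]
    nth_rewrite 3 [Finset.sum_comm]
    simp_rw [← Finset.sum_add_distrib]
    exact Finset.sum_congr rfl fun i _ => Finset.sum_congr rfl fun j _ => h1 i j
  rw [h3, ← two_smul ℝ, smul_smul]
  norm_num

lemma sum_ip_smul_bvec (X : so n) : ∑ p ∈ pairs n, ip X (bvec p.1 p.2) • bvec p.1 p.2 = X := by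
  rw [sum_pairs (fun i j => ip X (bvec i j) • bvec i j)
    (fun i j => by
      rw [bvec_swap, ip_bvec, ← neg_one_smul ℝ (bvec i j), ip_smul_right, smul_smul, ip_bvec]
      ring_nf)
    (fun i => by
      have : bvec i i = 0 := by
        ext k l
        rw [bvec_apply, sub_self]
        rfl
      rw [this, smul_zero])]
  ext k l
  simp only [ip_bvec, Submodule.coe_smul, Submodule.coe_sum, Matrix.smul_apply, Matrix.sum_apply,
    bvec_apply, smul_eq_mul, mul_sub, Finset.sum_sub_distrib]
  simp [so_apply_swap X k l]
  try ring

lemma eq_sum_smulRight (R : Module.End ℝ (so n)) :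
    R = ∑ p ∈ pairs n, (ipL (bvec p.1 p.2)).smulRight (R (bvec p.1 p.2)) := by
  ext1 X
  nth_rewrite 1 [← sum_ip_smul_bvec X]
  simp [LinearMap.sum_apply, ipL_apply, ip_comm X]

lemma eq_sum_Rcoord (R : Module.End ℝ (so n)) :
    R = ∑ p ∈ pairs n, ∑ q ∈ pairs n, ip (R (bvec p.1 p.2)) (bvec q.1 q.2) •
      (ipL (bvec p.1 p.2)).smulRight (bvec q.1 q.2) := by
  nth_rewrite 1 [eq_sum_smulRight R]
  refine Finset.sum_congr rfl fun p _ => ?_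
  nth_rewrite 1 [← sum_ip_smul_bvec (R (bvec p.1 p.2))]
  ext1 X
  simp [LinearMap.sum_apply, Finset.smul_sum, smul_smul, mul_comm]

lemma ext_Rcoord {R S : Module.End ℝ (so n)} (h : ∀ i j k l, Rcoord R i j k l = Rcoord S i j k l) :
    R = S := by
  rw [eq_sum_Rcoord R, eq_sum_Rcoord S]
  exact Finset.sum_congr rfl fun p _ => Finset.sum_congr rfl fun q _ =>
    congrArg (· • _) (h p.1 p.2 q.1 q.2)

lemma trace_eq_sum (R : Module.End ℝ (so n)) :
    LinearMap.trace ℝ (so n) R = ∑ p ∈ pairs n, ip (R (bvec p.1 p.2)) (bvec p.1 p.2) := by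
  nth_rewrite 1 [eq_sum_smulRight R]
  simp [LinearMap.trace_smulRight, ipL_apply, ip_comm]

lemma Rcoord_eq (R : Module.End ℝ (so n)) (i j k l : Fin n) :
    Rcoord R i j k l = (R (bvec i j) : Mat n) k l := ip_bvec _ _ _

lemma Rcoord_swap_left (R : Module.End ℝ (so n)) (i j k l : Fin n) :
    Rcoord R j i k l = -Rcoord R i j k l := by
  rw [Rcoord_eq, Rcoord_eq, bvec_swap, map_neg]
  rfl

lemma Rcoord_swap_right (R : Module.End ℝ (so n)) (i j k l : Fin n) :
    Rcoord R i j l k = -Rcoord R i j k l := by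
  rw [Rcoord_eq, Rcoord_eq, so_apply_swap]

lemma trace_RicM (R : Module.End ℝ (so n)) :
    Matrix.trace (RicM R) = 2 * LinearMap.trace ℝ (so n) R := by
  rw [trace_eq_sum]
  have := sum_pairs (fun i j => Rcoord R i j i j)
    (fun i j => by rw [Rcoord_swap_left, Rcoord_swap_right, neg_neg])
    (fun i => self_eq_neg.1 (Rcoord_swap_left R i i i i))
  simp only [Rcoord] at this
  rw [this]
  simp only [Matrix.trace, Matrix.diag, RicM, Matrix.of_apply, Rcoord, smul_eq_mul]
  ring

lemma Rcoord_one (i j k l : Fin n) : Rcoord (1 : Module.End ℝ (so n)) i j k l =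
    (if k = i then 1 else 0) * (if l = j then 1 else 0) -
      (if k = j then 1 else 0) * (if l = i then 1 else 0) := by
  rw [Rcoord_eq]
  exact bvec_apply i j k l

lemma isCurvOp_one : isCurvOp (1 : Module.End ℝ (so n)) := by
  refine ⟨fun X Y => rfl, fun i j k l => ?_⟩
  simp only [Rcoord_one, eq_comm (a := k) (b := i), eq_comm (a := k) (b := j),
    eq_comm (a := j) (b := i)]
  ring

/-- The space of curvature operators. -/
def curvOps (n : ℕ) : Submodule ℝ (Module.End ℝ (so n)) where
  carrier := {R | isCurvOp R}
  zero_mem' := by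
    refine ⟨fun X Y => ?_, fun i j k l => ?_⟩
    · simp [ip]
    · simp [Rcoord, ip]
  add_mem' := by
    rintro R S ⟨hR, hR'⟩ ⟨hS, hS'⟩
    refine ⟨fun X Y => ?_, fun i j k l => ?_⟩
    · rw [LinearMap.add_apply, LinearMap.add_apply, ip_add_left, ip_add_right, hR, hS]
    · have h1 := hR' i j k l
      have h2 := hS' i j k l
      simp only [Rcoord, LinearMap.add_apply, ip_add_left] at *
      linarith
  smul_mem' := by
    rintro c R ⟨hR, hR'⟩
    refine ⟨fun X Y => ?_, fun i j k l => ?_⟩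
    · rw [LinearMap.smul_apply, LinearMap.smul_apply, ip_smul_left, ip_smul_right, hR]
    · have h1 := hR' i j k l
      simp only [Rcoord, LinearMap.smul_apply, ip_smul_left] at *
      rw [← mul_add, ← mul_add, h1, mul_zero]

lemma mem_curvOps {R : Module.End ℝ (so n)} : R ∈ curvOps n ↔ isCurvOp R := Iff.rfl

/-! ### The quadratic vector field -/

lemma brk_add_left (A B X : so n) : brk (A + B) X = brk A X + brk B X := by
  ext1
  simp only [brk, Submodule.coe_add, add_mul, mul_add]
  abel

lemma brk_smul_left (c : ℝ) (A X : so n) : brk (c • A) X = c • brk A X := by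
  ext1
  simp only [brk, Submodule.coe_smul, smul_mul_assoc, mul_smul_comm, smul_sub]

lemma brk_add_right (X A B : so n) : brk X (A + B) = brk X A + brk X B := by
  ext1
  simp only [brk, Submodule.coe_add, add_mul, mul_add]
  abel

lemma brk_smul_right (c : ℝ) (X A : so n) : brk X (c • A) = c • brk X A := by
  ext1
  simp only [brk, Submodule.coe_smul, smul_mul_assoc, mul_smul_comm, smul_sub]

lemma ipL_add (A B : so n) : ipL (A + B) = ipL A + ipL B :=
  LinearMap.ext fun X => ip_add_left A B X

lemma ipL_smul (c : ℝ) (A : so n) : ipL (c • A) = c • ipL A :=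
  LinearMap.ext fun X => ip_smul_left c A X

/-- The bilinear map `(R, S) ↦ R S + R # S`, whose diagonal values are `Qode`. -/
def Qbil (n : ℕ) :
    Module.End ℝ (so n) →ₗ[ℝ] Module.End ℝ (so n) →ₗ[ℝ] Module.End ℝ (so n) :=
  LinearMap.mk₂ ℝ (fun R S => R * S + sharp R S)
    (fun R R' S => by
      have h : sharp (R + R') S = sharp R S + sharp R' S := by
        simp only [sharp, ← smul_add, ← Finset.sum_add_distrib]
        refine congrArg _ (Finset.sum_congr rfl fun p _ => Finset.sum_congr rfl fun q _ => ?_)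
        ext1 X
        simp only [LinearMap.add_apply, LinearMap.smulRight_apply, brk_add_left, ipL_add]
        module
      rw [h, add_mul]
      abel)
    (fun c R S => by
      have h : sharp (c • R) S = c • sharp R S := by
        simp only [sharp, smul_comm c (1 / 4 : ℝ), Finset.smul_sum (r := c)]
        refine congrArg _ (Finset.sum_congr rfl fun p _ => Finset.sum_congr rfl fun q _ => ?_)
        ext1 X
        simp only [LinearMap.add_apply, LinearMap.smul_apply, LinearMap.smulRight_apply,
          brk_smul_left, ipL_smul, smul_eq_mul]
        module
      rw [h, smul_mul_assoc, smul_add])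
    (fun R S S' => by
      have h : sharp R (S + S') = sharp R S + sharp R S' := by
        simp only [sharp, ← smul_add, ← Finset.sum_add_distrib]
        refine congrArg _ (Finset.sum_congr rfl fun p _ => Finset.sum_congr rfl fun q _ => ?_)
        ext1 X
        simp only [LinearMap.add_apply, LinearMap.smulRight_apply, brk_add_right, ipL_add]
        module
      rw [h, mul_add]
      abel)
    (fun c R S => by
      have h : sharp R (c • S) = c • sharp R S := by
        simp only [sharp, smul_comm c (1 / 4 : ℝ), Finset.smul_sum (r := c)]
        refine congrArg _ (Finset.sum_congr rfl fun p _ => Finset.sum_congr rfl fun q _ => ?_)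
        ext1 X
        simp only [LinearMap.add_apply, LinearMap.smul_apply, LinearMap.smulRight_apply,
          brk_smul_right, ipL_smul, smul_eq_mul]
        module
      rw [h, mul_smul_comm, smul_add])

lemma Qode_eq (R : Module.End ℝ (so n)) : Qode R = Qbil n R R := rfl

lemma Qode_smul (t : ℝ) (R : Module.End ℝ (so n)) : Qode (t • R) = t ^ 2 • Qode R := by
  simp only [Qode_eq, map_smul, LinearMap.smul_apply, smul_smul, sq]

lemma Qode_add_add_Qode_sub (R X : Module.End ℝ (so n)) :
    Qode (R + X) + Qode (R - X) = (2 : ℝ) • Qode R + (2 : ℝ) • Qode X := by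
  have h : R - X = R + (-1 : ℝ) • X := by module
  simp only [h, Qode_eq, map_add, map_smul, LinearMap.add_apply, LinearMap.smul_apply]
  module

/-! ### The Frobenius norm -/

lemma ip_self_nonneg (X : so n) : 0 ≤ ip X X := by
  rw [ip_eq_sum]
  exact mul_nonneg (by norm_num)
    (Finset.sum_nonneg fun i _ => Finset.sum_nonneg fun j _ => mul_self_nonneg _)

/-- The isometric embedding of the endomorphisms of `so n` into a Euclidean space given by the
(rescaled) coordinates. -/
def coordMap (n : ℕ) :
    Module.End ℝ (so n) →ₗ[ℝ] EuclideanSpace ℝ ((Fin n × Fin n) × (Fin n × Fin n)) where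
  toFun R := WithLp.toLp 2 fun p => 1 / 2 * Rcoord R p.1.1 p.1.2 p.2.1 p.2.2
  map_add' R S := by
    ext p
    simp only [Rcoord, LinearMap.add_apply, ip_add_left, PiLp.add_apply]
    ring
  map_smul' c R := by
    ext p
    simp only [Rcoord, LinearMap.smul_apply, ip_smul_left, PiLp.smul_apply, smul_eq_mul,
      RingHom.id_apply]
    ring

lemma coordMap_injective : Function.Injective (coordMap n) := fun R S h =>
  ext_Rcoord fun i j k l => by
    have := congrArg (fun x => x ((i, j), (k, l))) h
    simpa [coordMap] using this

/-- The endomorphisms of `so n` with the Frobenius norm. -/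
@[reducible] def endNormedAddCommGroup (n : ℕ) : NormedAddCommGroup (Module.End ℝ (so n)) :=
  NormedAddCommGroup.induced _ _ (coordMap n) coordMap_injective

attribute [local instance] endNormedAddCommGroup

/-- The endomorphisms of `so n` with the Frobenius norm. -/
@[reducible] def endNormedSpace (n : ℕ) : NormedSpace ℝ (Module.End ℝ (so n)) :=
  NormedSpace.induced ℝ _ _ (coordMap n)

attribute [local instance] endNormedSpace

lemma endNorm_sq (R : Module.End ℝ (so n)) :
    endNorm R ^ 2 = ∑ p ∈ pairs n, ip (R (bvec p.1 p.2)) (R (bvec p.1 p.2)) :=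
  Real.sq_sqrt (Finset.sum_nonneg fun _ _ => ip_self_nonneg _)

lemma norm_eq_endNorm (R : Module.End ℝ (so n)) : ‖R‖ = endNorm R := by
  refine (pow_left_inj₀ (norm_nonneg _) (Real.sqrt_nonneg _) two_ne_zero).1 ?_
  have h := sum_pairs (fun i j => ip (R (bvec i j)) (R (bvec i j)))
    (fun i j => by
      rw [bvec_swap, map_neg, ← neg_one_smul ℝ (R _), ip_smul_left, ip_smul_right]
      ring)
    (fun i => by simp [ip_eq_sum, ← Rcoord_eq, self_eq_neg.1 (Rcoord_swap_left R i i _ _)])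
  rw [← endNorm, endNorm_sq, h]
  have h2 : ‖R‖ = ‖coordMap n R‖ := rfl
  rw [h2, EuclideanSpace.norm_sq_eq]
  simp only [coordMap, LinearMap.coe_mk, AddHom.coe_mk, Real.norm_eq_abs, sq_abs,
    Fintype.sum_prod_type, ip_eq_sum, ← Rcoord_eq, smul_eq_mul, Finset.mul_sum]
  refine Finset.sum_congr rfl fun i _ => Finset.sum_congr rfl fun j _ =>
    Finset.sum_congr rfl fun k _ => Finset.sum_congr rfl fun l _ => ?_
  ring

lemma isClosedSet_iff {C : Set (Module.End ℝ (so n))} : isClosedSet C ↔ IsClosed C := by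
  simp only [isClosedSet, ← norm_eq_endNorm, ← dist_eq_norm, ← Metric.mem_closure_iff]
  exact ⟨isClosed_of_closure_subset, fun h X hX => h.closure_eq ▸ hX⟩

lemma mem_interiorCurv_iff {C : Set (Module.End ℝ (so n))} {X : curvOps n} :
    (X : Module.End ℝ (so n)) ∈ interiorCurv C ↔ X ∈ interior {Y : curvOps n | ↑Y ∈ C} := by
  rw [mem_interior_iff_mem_nhds, Metric.mem_nhds_iff]
  refine ⟨fun ⟨_, r, hr, h⟩ => ⟨r, hr, fun Y hY => h Y Y.2 ?_⟩,
    fun ⟨r, hr, h⟩ => ⟨X.2, r, hr, fun Y hY hYX => @h ⟨Y, hY⟩ ?_⟩⟩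
  · rwa [← norm_eq_endNorm, ← dist_eq_norm]
  · rwa [← norm_eq_endNorm, ← dist_eq_norm] at hYX

lemma parallelogram (R S : Module.End ℝ (so n)) :
    ‖R + S‖ ^ 2 + ‖R - S‖ ^ 2 = 2 * (‖R‖ ^ 2 + ‖S‖ ^ 2) := by
  have h := parallelogram_law_with_norm ℝ (coordMap n R) (coordMap n S)
  rw [← map_add, ← map_sub] at h
  exact h

/-! ### The action of `SO(n)` -/

lemma conjSo_apply (g : Mat n) (X : so n) : (conjSo g X : Mat n) = g * X * gᵀ := rfl

lemma conjSo_mul (g h : Mat n) : conjSo g * conjSo h = conjSo (g * h) := by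
  ext1 X
  ext1
  simp only [Module.End.mul_apply, conjSo_apply, Matrix.transpose_mul, Matrix.mul_assoc]

lemma conjSo_one : conjSo (1 : Mat n) = 1 := by
  ext1 X
  ext1
  simp [conjSo_apply]

lemma ip_conjSo (g : Mat n) (X Y : so n) : ip (conjSo g X) Y = ip X (conjSo gᵀ Y) := by
  simp only [ip, conjSo_apply, Matrix.transpose_transpose, Matrix.mul_assoc]
  rw [Matrix.trace_mul_comm g]
  simp only [Matrix.mul_assoc]

lemma onAct_add (g : Mat n) (R S : Module.End ℝ (so n)) :
    onAct g (R + S) = onAct g R + onAct g S := by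
  simp only [onAct, mul_add, add_mul]

lemma onAct_smul (g : Mat n) (c : ℝ) (R : Module.End ℝ (so n)) :
    onAct g (c • R) = c • onAct g R := by
  simp only [onAct, mul_smul_comm, smul_mul_assoc]

lemma onAct_one {g : Mat n} (hg : g * gᵀ = 1) : onAct g 1 = 1 := by
  rw [onAct, mul_one, conjSo_mul, hg, conjSo_one]

lemma onAct_mul_onAct {g : Mat n} (hg : g * gᵀ = 1) (R S : Module.End ℝ (so n)) :
    onAct g R * onAct g S = onAct g (R * S) := by
  have h : conjSo gᵀ * conjSo g = 1 := by rw [conjSo_mul, mul_eq_one_comm.1 hg, conjSo_one]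
  simp only [onAct, mul_assoc]
  rw [← mul_assoc (conjSo gᵀ), h, one_mul]

lemma trace_onAct {g : Mat n} (hg : g * gᵀ = 1) (R : Module.End ℝ (so n)) :
    LinearMap.trace ℝ (so n) (onAct g R) = LinearMap.trace ℝ (so n) R := by
  rw [onAct, LinearMap.trace_mul_comm, ← mul_assoc, conjSo_mul, mul_eq_one_comm.1 hg, conjSo_one,
    one_mul]

lemma selfAdjEnd_onAct (g : Mat n) {R : Module.End ℝ (so n)} (hR : selfAdjEnd R) :
    selfAdjEnd (onAct g R) := fun X Y => by
  simp only [onAct, Module.End.mul_apply, ip_conjSo, Matrix.transpose_transpose, hR _ _]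

lemma norm_sq_eq_trace {R : Module.End ℝ (so n)} (hR : selfAdjEnd R) :
    ‖R‖ ^ 2 = LinearMap.trace ℝ (so n) (R * R) := by
  rw [norm_eq_endNorm, endNorm_sq, trace_eq_sum]
  exact Finset.sum_congr rfl fun p _ => (hR _ _).symm

lemma norm_onAct {g : Mat n} (hg : g * gᵀ = 1) {R : Module.End ℝ (so n)} (hR : selfAdjEnd R) :
    ‖onAct g R‖ = ‖R‖ := by
  refine (pow_left_inj₀ (norm_nonneg _) (norm_nonneg _) two_ne_zero).1 ?_
  rw [norm_sq_eq_trace hR, norm_sq_eq_trace (selfAdjEnd_onAct g hR), onAct_mul_onAct hg,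
    trace_onAct hg]

/-! ### `SO(n)`-invariant curvature operators -/

/-- The rotation by `π/2` in the plane spanned by `e_j` and `e_k`. -/
def rotation (j k : Fin n) : Mat n :=
  (Equiv.swap j k).permMatrix ℝ * Matrix.diagonal (Function.update 1 j (-1))

lemma rotation_mul_transpose (j k : Fin n) : rotation j k * (rotation j k)ᵀ = 1 := by
  have h : (Matrix.diagonal (Function.update 1 j (-1)) : Mat n) *
      Matrix.diagonal (Function.update 1 j (-1)) = 1 := by
    rw [Matrix.diagonal_mul_diagonal, ← Matrix.diagonal_one]
    congr 1
    ext i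
    by_cases hi : i = j <;> simp [hi]
  rw [rotation, Matrix.transpose_mul, Matrix.diagonal_transpose, Matrix.mul_assoc,
    ← Matrix.mul_assoc (Matrix.diagonal _), h, Matrix.one_mul, Matrix.transpose_permMatrix,
    ← Matrix.permMatrix_mul, inv_mul_cancel, Matrix.permMatrix_one]

lemma det_rotation {j k : Fin n} (hjk : j ≠ k) : (rotation j k).det = 1 := by
  rw [rotation, Matrix.det_mul, Matrix.det_permutation, Equiv.Perm.sign_swap hjk,
    Matrix.det_diagonal, Finset.prod_update_of_mem (Finset.mem_univ j)]
  simp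

lemma rotation_mulVec (j k i : Fin n) : rotation j k *ᵥ evec i =
    (if i = j then (-1 : ℝ) else 1) • evec (Equiv.swap j k i) := by
  rw [rotation, ← Matrix.mulVec_mulVec, Matrix.permMatrix_mulVec]
  ext m
  simp only [Function.comp_apply, Matrix.mulVec_diagonal, Function.update_apply, Pi.one_apply,
    evec, Pi.smul_apply, smul_eq_mul]
  by_cases h : Equiv.swap j k m = i
  · simp [← h]
  · have h' : m ≠ Equiv.swap j k i := fun h' => h (by rw [h', Equiv.swap_apply_self])
    simp [h, h']

lemma conjSo_vwedge (g : Mat n) (v w : Fin n → ℝ) :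
    conjSo g (vwedge v w) = vwedge (g *ᵥ v) (g *ᵥ w) := by
  have h : ∀ v w : Fin n → ℝ, (vwedge v w : Mat n) = vecMulVec v w - vecMulVec w v :=
    fun v w => rfl
  ext1
  rw [conjSo_apply, h, h, Matrix.mul_sub, Matrix.sub_mul, Matrix.mul_vecMulVec,
    Matrix.mul_vecMulVec, Matrix.vecMulVec_mul, Matrix.vecMulVec_mul, Matrix.vecMul_transpose,
    Matrix.vecMul_transpose]

lemma vwedge_smul_smul (a b : ℝ) (v w : Fin n → ℝ) :
    vwedge (a • v) (b • w) = (a * b) • vwedge v w := by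
  ext k l
  simp only [vwedge, Matrix.of_apply, Pi.smul_apply, smul_eq_mul, Submodule.coe_smul,
    Matrix.smul_apply]
  ring

lemma Rcoord_rotation {R : Module.End ℝ (so n)} {j k : Fin n}
    (hR : onAct (rotation j k) R = R) (a b c d : Fin n) :
    Rcoord R a b c d =
      ((if a = j then (-1 : ℝ) else 1) * (if b = j then (-1 : ℝ) else 1)) *
      ((if c = j then (-1 : ℝ) else 1) * (if d = j then (-1 : ℝ) else 1)) *
      Rcoord R (Equiv.swap j k a) (Equiv.swap j k b) (Equiv.swap j k c) (Equiv.swap j k d) := by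
  set g := rotation j k with hg
  have h1 : conjSo gᵀ * conjSo g = 1 := by
    rw [conjSo_mul, mul_eq_one_comm.1 (rotation_mul_transpose j k), conjSo_one]
  have h2 : ∀ X, R (conjSo g X) = conjSo g (R X) := by
    intro X
    nth_rewrite 1 [← hR]
    rw [onAct, Module.End.mul_apply, ← Module.End.mul_apply (conjSo gᵀ), h1]
    rfl
  have h3 : ∀ X Y : so n, ip X Y = ip (conjSo g X) (conjSo g Y) := by
    intro X Y
    rw [ip_conjSo, ← Module.End.mul_apply, h1]
    rfl
  have h4 : ∀ i l, conjSo g (bvec i l) = ((if i = j then (-1 : ℝ) else 1) *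
      (if l = j then (-1 : ℝ) else 1)) • bvec (Equiv.swap j k i) (Equiv.swap j k l) := by
    intro i l
    rw [bvec, conjSo_vwedge, rotation_mulVec, rotation_mulVec, vwedge_smul_smul, bvec]
  rw [Rcoord, h3, ← h2, h4, h4, map_smul, ip_smul_left, ip_smul_right, Rcoord]
  ring

lemma Rcoord_symm {R : Module.End ℝ (so n)} (hR : selfAdjEnd R) (i j k l : Fin n) :
    Rcoord R k l i j = Rcoord R i j k l := by
  rw [Rcoord, hR, ip_comm, Rcoord]

/-- An `SO(n)`-invariant curvature operator is a multiple of the identity. -/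
lemma exists_eq_smul_one (hn : 3 ≤ n) {R : Module.End ℝ (so n)} (hR : isCurvOp R)
    (hinv : ∀ g : Mat n, g * gᵀ = 1 → g.det = 1 → onAct g R = R) : ∃ c : ℝ, R = c • 1 := by
  have hrot : ∀ {j k : Fin n}, j ≠ k → _ := fun {j k} hjk => Rcoord_rotation
    (hinv (rotation j k) (rotation_mul_transpose j k) (det_rotation hjk))
  have hthree : ∀ {i j l : Fin n}, i ≠ j → i ≠ l → j ≠ l → Rcoord R i j i l = 0 := by
    intro i j l hij hil hjl
    have h := hrot hjl i j i l
    rw [Equiv.swap_apply_of_ne_of_ne hij hil, Equiv.swap_apply_left, Equiv.swap_apply_right,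
      if_neg hij, if_pos rfl, if_neg hjl.symm, Rcoord_symm hR.1 i j i l] at h
    linarith
  have hfour : ∀ {i j k l : Fin n}, i ≠ j → i ≠ k → i ≠ l → j ≠ k → j ≠ l → k ≠ l →
      Rcoord R i j k l = 0 := by
    have hcycle : ∀ {i j k l : Fin n}, i ≠ j → i ≠ k → j ≠ k → j ≠ l → k ≠ l →
        Rcoord R k i j l = Rcoord R i j k l := by
      intro i j k l hij hik hjk hjl hkl
      have h := hrot hjk i j k l
      rw [Equiv.swap_apply_of_ne_of_ne hij hik, Equiv.swap_apply_left, Equiv.swap_apply_right,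
        Equiv.swap_apply_of_ne_of_ne hjl.symm hkl.symm, if_neg hij, if_pos rfl, if_neg hjk.symm,
        if_neg hjl.symm, Rcoord_swap_left R k i j l] at h
      linarith
    intro i j k l hij hik hil hjk hjl hkl
    have h1 := hR.2 i j k l
    have h2 := hcycle hij hik hjk hjl hkl
    have h3 := hcycle hik.symm hjk.symm hij hil hjl
    linarith
  have htwo : ∀ {i j k : Fin n}, i ≠ j → i ≠ k → Rcoord R i j i j = Rcoord R i k i k := by
    intro i j k hij hik
    rcases eq_or_ne j k with rfl | hjk
    · rfl
    have h := hrot hjk i j i j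
    rw [Equiv.swap_apply_of_ne_of_ne hij hik, Equiv.swap_apply_left, if_neg hij, if_pos rfl] at h
    linarith
  have hflip : ∀ i j : Fin n, Rcoord R i j i j = Rcoord R j i j i := fun i j => by
    rw [Rcoord_swap_left, Rcoord_swap_right, neg_neg]
  have hdiag : ∀ i j k l : Fin n, i ≠ j → k ≠ l → Rcoord R i j i j = Rcoord R k l k l := by
    intro i j k l hij hkl
    rcases eq_or_ne i k with rfl | hik
    · exact htwo hij hkl
    · rw [htwo hij hik, hflip, htwo hik.symm hkl]
  set a : Fin n := ⟨0, by omega⟩ with ha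
  set b : Fin n := ⟨1, by omega⟩ with hb
  have hab : a ≠ b := by simp [ha, hb]
  refine ⟨Rcoord R a b a b, ext_Rcoord fun i j k l => ?_⟩
  have hsmul : Rcoord (Rcoord R a b a b • (1 : Module.End ℝ (so n))) i j k l =
      Rcoord R a b a b * Rcoord (1 : Module.End ℝ (so n)) i j k l := by
    simp only [Rcoord, LinearMap.smul_apply, ip_smul_left]
  rw [hsmul]
  by_cases hij : i = j
  · subst hij
    rw [self_eq_neg.1 (Rcoord_swap_left R i i k l), self_eq_neg.1 (Rcoord_swap_left 1 i i k l),
      mul_zero]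
  by_cases hkl : k = l
  · subst hkl
    rw [self_eq_neg.1 (Rcoord_swap_right R i j k k), self_eq_neg.1 (Rcoord_swap_right 1 i j k k),
      mul_zero]
  by_cases hki : k = i
  · subst hki
    by_cases hlj : l = j
    · subst hlj
      simp [Rcoord_one, hij, hdiag k l a b hij hab]
    · simp [Rcoord_one, hij, hlj, hthree hij hkl (Ne.symm hlj)]
  by_cases hkj : k = j
  · subst hkj
    by_cases hli : l = i
    · subst hli
      rw [Rcoord_swap_right, hdiag l k a b hij hab]
      simp [Rcoord_one, hkl]
    · rw [Rcoord_swap_left, hthree hki hkl (Ne.symm hli)]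
      simp [Rcoord_one, hki, hli]
  by_cases hli : l = i
  · subst hli
    rw [Rcoord_swap_right, hthree hij (Ne.symm hki) (Ne.symm hkj)]
    simp [Rcoord_one, hki, hkj]
  by_cases hlj : l = j
  · subst hlj
    rw [Rcoord_swap_left, Rcoord_swap_right, hthree (Ne.symm hij) (Ne.symm hkl) (Ne.symm hki)]
    simp [Rcoord_one, hki, hkl]
  rw [hfour hij (Ne.symm hki) (Ne.symm hli) (Ne.symm hkj) (Ne.symm hlj) hkl]
  simp [Rcoord_one, hki, hkj]

/-! ### Invariant cones of curvature operators -/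

lemma interiorCurv_subset (K : Set (Module.End ℝ (so n))) : interiorCurv K ⊆ K :=
  fun R ⟨hR, r, hr, h⟩ => h R hR (by rwa [← norm_eq_endNorm, sub_self, norm_zero])

lemma exists_add_smul_mem_of_interiorCurv {K : Set (Module.End ℝ (so n))}
    {R X : Module.End ℝ (so n)} (hR : R ∈ interiorCurv K) (hX : isCurvOp X) :
    ∃ t > (0 : ℝ), R + t • X ∈ K ∧ R - t • X ∈ K := by
  obtain ⟨hRc, r, hr, h⟩ := hR
  have ht : (0 : ℝ) < r / (‖X‖ + 1) := by positivity
  have hlt : ‖(r / (‖X‖ + 1)) • X‖ < r := by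
    rw [norm_smul, Real.norm_eq_abs, abs_of_pos ht, div_mul_eq_mul_div,
      div_lt_iff₀ (by positivity)]
    linarith
  have htX := (curvOps n).smul_mem (r / (‖X‖ + 1)) hX
  refine ⟨_, ht, h _ ((curvOps n).add_mem hRc htX) ?_, h _ ((curvOps n).sub_mem hRc htX) ?_⟩
  · rwa [← norm_eq_endNorm, add_sub_cancel_left]
  · rwa [← norm_eq_endNorm, sub_sub_cancel_left, norm_neg]

/-- If `Qode` maps a set with nonempty interior to curvature operators, then it maps all curvature
operators to curvature operators. -/
lemma isCurvOp_Qode {K : Set (Module.End ℝ (so n))} {R : Module.End ℝ (so n)}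
    (hR : R ∈ interiorCurv K) (hK : ∀ S ∈ K, isCurvOp (Qode S)) {X : Module.End ℝ (so n)}
    (hX : isCurvOp X) : isCurvOp (Qode X) := by
  obtain ⟨t, ht, h1, h2⟩ := exists_add_smul_mem_of_interiorCurv hR hX
  have h3 := (curvOps n).sub_mem ((curvOps n).add_mem (hK _ h1) (hK _ h2))
    ((curvOps n).smul_mem 2 (hK _ (interiorCurv_subset K hR)))
  rw [Qode_add_add_Qode_sub, add_sub_cancel_left, Qode_smul, smul_smul] at h3
  exact ((curvOps n).smul_mem_iff (by positivity)).1 h3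

/-- If the action of `g` maps a set with nonempty interior to curvature operators, then it maps all
curvature operators to curvature operators. -/
lemma isCurvOp_onAct {K : Set (Module.End ℝ (so n))} {R : Module.End ℝ (so n)}
    (hR : R ∈ interiorCurv K) {g : Mat n} (hK : ∀ S ∈ K, isCurvOp (onAct g S))
    {X : Module.End ℝ (so n)} (hX : isCurvOp X) : isCurvOp (onAct g X) := by
  obtain ⟨t, ht, h1, -⟩ := exists_add_smul_mem_of_interiorCurv hR hX
  have h3 := (curvOps n).sub_mem (hK _ h1) (hK _ (interiorCurv_subset K hR))
  rw [onAct_add, add_sub_cancel_left, onAct_smul] at h3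
  exact ((curvOps n).smul_mem_iff ht.ne').1 h3

lemma trace_one_pos (hn : 3 ≤ n) : 0 < LinearMap.trace ℝ (so n) 1 := by
  have h : bvec (⟨0, by omega⟩ : Fin n) ⟨1, by omega⟩ ≠ 0 := fun h => by
    have := congrArg (fun X : so n => (X : Mat n) ⟨0, by omega⟩ ⟨1, by omega⟩) h
    simp [bvec_apply] at this
  have : Nontrivial (so n) := ⟨_, _, h⟩
  rw [LinearMap.trace_one]
  exact_mod_cast Module.finrank_pos (R := ℝ) (M := so n)

/-- The identity is an interior point of every closed convex `SO(n)`-invariant cone with nonempty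
interior on which the scalar curvature is positive. -/
lemma one_mem_interiorCurv (hn : 3 ≤ n) {K : Set (Module.End ℝ (so n))}
    (hcurv : ∀ R ∈ K, isCurvOp R) (hclosed : isClosedSet K) (hconv : Convex ℝ K)
    (hcone : ∀ R ∈ K, ∀ t : ℝ, 0 ≤ t → t • R ∈ K)
    (hinv : ∀ g : Mat n, g * gᵀ = 1 → g.det = 1 → ∀ R ∈ K, onAct g R ∈ K)
    (hfull : ∃ R, R ∈ interiorCurv K) (hscal : ∀ R ∈ K, R ≠ 0 → 0 < Matrix.trace (RicM R)) :
    1 ∈ interiorCurv K := by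
  obtain ⟨R₀, hR₀⟩ := hfull
  have hact : ∀ g : Mat n, g * gᵀ = 1 → g.det = 1 → ∀ X, isCurvOp X → isCurvOp (onAct g X) :=
    fun g hg hg' X hX => isCurvOp_onAct hR₀ (fun S hS => hcurv _ (hinv g hg hg' S hS)) hX
  obtain ⟨hR₀c, r, hr, hball⟩ := hR₀
  set ρ := r / 2 with hρ_def
  have hρ : 0 < ρ := half_pos hr
  set K' : Set (curvOps n) :=
    {X | ∀ v : curvOps n, ‖v‖ ≤ ρ → ((X + v : curvOps n) : Module.End ℝ (so n)) ∈ K} with hK'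
  have hK'closed : IsClosed K' := by
    simp only [hK', Set.ofPred_forall]
    exact isClosed_iInter fun v => isClosed_iInter fun _ => (isClosedSet_iff.1 hclosed).preimage
      (continuous_subtype_val.comp (continuous_add_const v))
  have hK'ne : K'.Nonempty := ⟨⟨R₀, hR₀c⟩, fun v hv => hball _ (Subtype.prop _) (by
    rw [← norm_eq_endNorm, Submodule.coe_add, add_sub_cancel_left]
    exact lt_of_le_of_lt hv (half_lt_self hr))⟩
  obtain ⟨X₀, hX₀, hmin⟩ := hK'closed.exists_infDist_eq_dist hK'ne 0
  have hle : ∀ Y ∈ K', ‖X₀‖ ≤ ‖Y‖ := fun Y hY => by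
    have := Metric.infDist_le_dist_of_mem (x := 0) hY
    rwa [hmin, dist_zero_left, dist_zero_left] at this
  have huniq : ∀ Y ∈ K', ‖Y‖ = ‖X₀‖ → Y = X₀ := by
    intro Y hY hYn
    have hmid : (1 / 2 : ℝ) • (Y + X₀) ∈ K' := fun v hv => by
      have := hconv (hY v hv) (hX₀ v hv) (a := 1 / 2) (b := 1 / 2) (by norm_num) (by norm_num)
        (by norm_num)
      convert this using 1
      simp only [Submodule.coe_add, Submodule.coe_smul]
      module
    have h1 := hle _ hmid
    rw [norm_smul, Real.norm_eq_abs, abs_of_pos (by norm_num)] at h1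
    have h2 : ‖Y + X₀‖ ^ 2 + ‖Y - X₀‖ ^ 2 = 2 * (‖Y‖ ^ 2 + ‖X₀‖ ^ 2) :=
      parallelogram (Y : Module.End ℝ (so n)) X₀
    rw [hYn] at h2
    have h3 : ‖Y - X₀‖ ^ 2 ≤ 0 := by nlinarith [norm_nonneg X₀]
    exact sub_eq_zero.1 (norm_eq_zero.1 (pow_eq_zero_iff two_ne_zero |>.1
      (le_antisymm h3 (sq_nonneg _))))
  obtain ⟨c, hc⟩ : ∃ c : ℝ, (X₀ : Module.End ℝ (so n)) = c • 1 := by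
    refine exists_eq_smul_one hn X₀.2 fun g hg hg' => ?_
    refine congrArg Subtype.val (huniq ⟨onAct g X₀, hact g hg hg' X₀ X₀.2⟩ (fun v hv => ?_)
      (norm_onAct hg (mem_curvOps.1 X₀.2).1))
    have hgt : gᵀ * gᵀᵀ = 1 := by rw [Matrix.transpose_transpose, mul_eq_one_comm.1 hg]
    have hv' := hact gᵀ hgt (by rwa [Matrix.det_transpose]) v v.2
    have h1 := hinv g hg hg' _ (hX₀ ⟨_, hv'⟩
      (le_of_eq_of_le (norm_onAct hgt (mem_curvOps.1 v.2).1) hv))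
    have h2 : onAct g (onAct gᵀ (v : Module.End ℝ (so n))) = v := by
      simp only [onAct, Matrix.transpose_transpose, mul_assoc, conjSo_mul, hg, conjSo_one, mul_one]
      rw [← mul_assoc, conjSo_mul, hg, conjSo_one, one_mul]
    rwa [Submodule.coe_add, onAct_add, h2] at h1
  have hsmall : ∀ v, isCurvOp v → ‖v‖ ≤ ρ → c • 1 + v ∈ K := fun v hv hvn => by
    rw [← hc]
    exact hX₀ ⟨v, hv⟩ hvn
  have hc0 : 0 < c := by
    by_contra! hc0
    set t := ρ / (‖(1 : Module.End ℝ (so n))‖ + 1) with ht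
    have ht0 : 0 < t := by positivity
    have h1 := hsmall ((-t) • 1) ((curvOps n).smul_mem _ isCurvOp_one) (by
      rw [norm_smul, Real.norm_eq_abs, abs_neg, abs_of_pos ht0, ht, div_mul_eq_mul_div,
        div_le_iff₀ (by positivity)]
      nlinarith)
    rw [← add_smul] at h1
    have htr := trace_one_pos hn
    have hne : (c + -t) • (1 : Module.End ℝ (so n)) ≠ 0 :=
      smul_ne_zero (by linarith) fun h => by rw [h, map_zero] at htr; exact htr.false
    have h2 := hscal _ h1 hne
    rw [trace_RicM, map_smul, smul_eq_mul] at h2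
    nlinarith
  refine ⟨isCurvOp_one, ρ / c, by positivity, fun Y hY hYn => ?_⟩
  rw [← norm_eq_endNorm, lt_div_iff₀ hc0] at hYn
  have h1 := hcone _ (hsmall (c • (Y - 1))
    ((curvOps n).smul_mem _ ((curvOps n).sub_mem hY isCurvOp_one)) (by
      rw [norm_smul, Real.norm_eq_abs, abs_of_pos hc0]
      linarith)) c⁻¹ (by positivity)
  rwa [← smul_add, inv_smul_smul₀ hc0.ne', add_sub_cancel] at h1

/-! ### The pinching family of curvature cones -/

lemma exists_lipschitz_Qode (n : ℕ) : ∃ M : ℝ, 0 ≤ M ∧ ∀ X Y : Module.End ℝ (so n),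
    ‖Qode X - Qode Y‖ ≤ M * ‖X - Y‖ * (‖X‖ + ‖Y‖) := by
  obtain ⟨B, hB⟩ : ∃ B : Module.End ℝ (so n) →L[ℝ] Module.End ℝ (so n) →L[ℝ] Module.End ℝ (so n),
      ∀ R S, B R S = Qbil n R S := ⟨(Qbil n).toContinuousBilinearMap, fun R S => rfl⟩
  refine ⟨‖B‖, B.opNorm_nonneg, fun X Y => ?_⟩
  have h : Qode X - Qode Y = B (X - Y) X + B Y (X - Y) := by
    rw [Qode_eq, Qode_eq, ← hB, ← hB, map_sub, map_sub, _root_.sub_apply]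
    abel
  rw [h]
  refine (norm_add_le _ _).trans
    ((add_le_add (B.le_opNorm₂ _ _) (B.le_opNorm₂ _ _)).trans_eq ?_)
  ring

open Set Topology in
/-- A family of cones of curvature operators as in the theorem yields a pinching family in the
space of curvature operators. -/
lemma exists_pinchingFamily (hn : 3 ≤ n) (C : ℝ → Set (Module.End ℝ (so n)))
    (hcurv : ∀ s ∈ Ico (0 : ℝ) 1, ∀ R ∈ C s, isCurvOp R)
    (hclosed : ∀ s ∈ Ico (0 : ℝ) 1, isClosedSet (C s))
    (hconv : ∀ s ∈ Ico (0 : ℝ) 1, Convex ℝ (C s))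
    (hcone : ∀ s ∈ Ico (0 : ℝ) 1, ∀ R ∈ C s, ∀ t : ℝ, 0 ≤ t → t • R ∈ C s)
    (hSOinv : ∀ s ∈ Ico (0 : ℝ) 1, ∀ g : Mat n, g * gᵀ = 1 → g.det = 1 →
      ∀ R ∈ C s, onAct g R ∈ C s)
    (hfull : ∀ s ∈ Ico (0 : ℝ) 1, ∃ R, R ∈ interiorCurv (C s))
    (hcont : ∀ s₀ ∈ Ico (0 : ℝ) 1, ∀ ε > (0 : ℝ), ∃ δ > (0 : ℝ), ∀ s ∈ Ico (0 : ℝ) 1,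
      |s - s₀| < δ → hdClose (truncSet (C s)) (truncSet (C s₀)) ε)
    (hscal : ∀ s ∈ Ico (0 : ℝ) 1, ∀ R ∈ C s, R ≠ 0 → 0 < Matrix.trace (RicM R))
    (hodeInt : ∀ s ∈ Ioo (0 : ℝ) 1, ∀ R ∈ C s, R ≠ 0 →
      Qode R ∈ interiorCurv (tangCone (C s) R)) :
    ∃ 𝓕 : PinchingFamily (curvOps n), (∀ s X, X ∈ 𝓕.C s ↔ ↑X ∈ C s) ∧
      (∀ X, (𝓕.Q X : Module.End ℝ (so n)) = Qode X) ∧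
      (∀ X, 𝓕.ℓ X = LinearMap.trace ℝ (so n) X) ∧
      ∀ g : Mat n, g * gᵀ = 1 → g.det = 1 → ∃ f ∈ 𝓕.G,
        ∀ X, (f X : Module.End ℝ (so n)) = onAct g X := by
  have hhalf : (1 / 2 : ℝ) ∈ Ioo (0 : ℝ) 1 := ⟨by norm_num, by norm_num⟩
  have hhalf' := Ioo_subset_Ico_self hhalf
  obtain ⟨R₀, hR₀⟩ := hfull (1 / 2) hhalf'
  have hQ : ∀ X : curvOps n, isCurvOp (Qode (X : Module.End ℝ (so n))) := fun X =>
    isCurvOp_Qode hR₀ (fun S hS => by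
      rcases eq_or_ne S 0 with rfl | hS0
      · rw [Qode_eq, map_zero]
        exact (curvOps n).zero_mem
      · exact (hodeInt _ hhalf S hS hS0).1) X.2
  have hact : ∀ g : Mat n, g * gᵀ = 1 → g.det = 1 → ∀ X, isCurvOp X → isCurvOp (onAct g X) :=
    fun g hg hg' X hX => isCurvOp_onAct hR₀ (fun S hS =>
      hcurv _ hhalf' _ (hSOinv _ hhalf' g hg hg' S hS)) hX
  obtain ⟨M, hM, hlip⟩ := exists_lipschitz_Qode n
  let 𝓕 : PinchingFamily (curvOps n) :=
    { C := fun s => {X | ↑X ∈ C s}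
      e := ⟨1, isCurvOp_one⟩
      ℓ := ((LinearMap.trace ℝ (so n)).domRestrict (curvOps n)).toContinuousLinearMap
      Q := fun X => ⟨Qode X, hQ X⟩
      M := M
      G := {f | ∃ g : Mat n, g * gᵀ = 1 ∧ g.det = 1 ∧
        ∀ X, (f X : Module.End ℝ (so n)) = onAct g X}
      closed := fun s hs => (isClosedSet_iff.1 (hclosed s hs)).preimage continuous_subtype_val
      convex := fun s hs X hX Y hY a b ha hb hab => hconv s hs hX hY ha hb hab
      smul_mem := fun s hs X hX t ht => hcone s hs X hX t ht
      e_mem := fun s hs => mem_interiorCurv_iff.1 (one_mem_interiorCurv hn (hcurv s hs)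
        (hclosed s hs) (hconv s hs) (hcone s hs) (hSOinv s hs) (hfull s hs) (hscal s hs))
      hausdorff := fun s₀ hs₀ θ hθ => by
        obtain ⟨δ, hδ, h⟩ := hcont s₀ hs₀ θ hθ
        refine Metric.mem_nhdsWithin_iff.2 ⟨δ, hδ, fun s ⟨hs, hsI⟩ => ?_⟩
        obtain ⟨h1, h2⟩ := h s hsI hs
        refine ⟨fun X hX hX1 => ?_, fun X hX hX1 => ?_⟩
        · obtain ⟨Y, hY, hXY⟩ := h1 X ⟨hX, by rwa [← norm_eq_endNorm]⟩
          exact ⟨⟨Y, hcurv s₀ hs₀ Y hY.1⟩, hY.1, by rwa [← norm_eq_endNorm] at hXY⟩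
        · obtain ⟨Y, hY, hXY⟩ := h2 X ⟨hX, by rwa [← norm_eq_endNorm]⟩
          refine ⟨⟨Y, hcurv s hsI Y hY.1⟩, hY.1, ?_⟩
          rw [norm_sub_rev]
          rwa [← norm_eq_endNorm] at hXY
      pos := fun s hs X hX hX0 => by
        have h := hscal s hs X hX (by simpa using hX0)
        rw [trace_RicM] at h
        exact pos_of_mul_pos_right h (by norm_num)
      M_nonneg := hM
      lipschitz := fun X Y => hlip X Y
      Q_smul := fun t X => by
        ext1
        simp only [Submodule.coe_smul, Qode_smul]
      tangent := fun s hs X hX hX0 => by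
        obtain ⟨-, δ, hδ, h⟩ := hodeInt s hs X hX (by simpa using hX0)
        refine ⟨δ, hδ, fun Y hY ρ hρ => ?_⟩
        obtain ⟨S, hS, t, ht, hlt⟩ := h Y Y.2 (by rwa [← norm_eq_endNorm]) ρ hρ
        exact ⟨⟨S, hcurv s (Ioo_subset_Ico_self hs) S hS⟩, hS, t, ht,
          by rwa [← norm_eq_endNorm] at hlt⟩
      G_C := by
        rintro f ⟨g, hg, hg', hf⟩ s hs X hX
        simpa [hf] using hSOinv s hs g hg hg' X hX
      G_e := by
        rintro f ⟨g, hg, hg', hf⟩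
        exact Subtype.ext ((hf _).trans (onAct_one hg))
      G_ℓ := by
        rintro f ⟨g, hg, hg', hf⟩ X
        simp [hf, trace_onAct hg] }
  refine ⟨𝓕, fun s X => Iff.rfl, fun X => rfl, fun X => rfl, fun g hg hg' => ?_⟩
  let f : Module.End ℝ (so n) →ₗ[ℝ] Module.End ℝ (so n) :=
    { toFun := onAct g
      map_add' := onAct_add g
      map_smul' := onAct_smul g }
  exact ⟨f.restrict (hact g hg hg'), ⟨g, hg, hg', fun X => rfl⟩, fun X => rfl⟩

/-- A curve of endomorphisms whose coordinates are differentiable is differentiable. -/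
lemma hasDerivWithinAt_of_coord {Rc : ℝ → Module.End ℝ (so n)} {R' : Module.End ℝ (so n)}
    {I : Set ℝ} {t : ℝ}
    (h : ∀ p ∈ pairs n, ∀ q ∈ pairs n,
      HasDerivWithinAt (fun u => ip (Rc u (bvec p.1 p.2)) (bvec q.1 q.2))
        (ip (R' (bvec p.1 p.2)) (bvec q.1 q.2)) I t) :
    HasDerivWithinAt Rc R' I t := by
  rw [funext fun u => eq_sum_Rcoord (Rc u), eq_sum_Rcoord R']
  exact HasDerivWithinAt.fun_sum fun p hp => HasDerivWithinAt.fun_sum fun q hq =>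
    (h p hp q hq).smul_const _

/-- A set of curvature operators invariant under the differential equation in the space of
curvature operators. -/
lemma mem_of_odeInvariant {Q : curvOps n → curvOps n}
    (hQ : ∀ X, (Q X : Module.End ℝ (so n)) = Qode X) {S : Set (curvOps n)}
    (hS : ODEInvariant Q S) {T : ℝ} {Rc : ℝ → Module.End ℝ (so n)}
    (hRc : ∀ t ∈ Set.Ico (0 : ℝ) T, isCurvOp (Rc t))
    (hderiv : ∀ t ∈ Set.Ico (0 : ℝ) T,
      HasDerivWithinAt Rc (Qode (Rc t)) (Set.Ico (0 : ℝ) T) t)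
    (h0 : Rc 0 ∈ Subtype.val '' S) : ∀ t ∈ Set.Ico (0 : ℝ) T, Rc t ∈ Subtype.val '' S := by
  obtain ⟨P, hP⟩ := (curvOps n).subtype.exists_leftInverse_of_injective (curvOps n).ker_subtype
  have hP' : ∀ X : curvOps n, P X = X := fun X => LinearMap.congr_fun hP X
  have hPR : ∀ t ∈ Set.Ico (0 : ℝ) T, (P (Rc t) : Module.End ℝ (so n)) = Rc t := fun t ht =>
    congrArg Subtype.val (hP' ⟨Rc t, hRc t ht⟩)
  intro t ht
  refine ⟨P (Rc t), hS T (fun u => P (Rc u)) (fun u hu => ?_) ?_ t ht, hPR t ht⟩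
  · have h := P.toContinuousLinearMap.hasFDerivAt.comp_hasDerivWithinAt u (hderiv u hu)
    have hQP : P (Qode (Rc u)) = Q (P (Rc u)) := by rw [← hP' (Q _), hQ, hPR u hu]
    exact HasDerivWithinAt.congr_deriv h hQP
  · obtain ⟨X, hX, hX0⟩ := h0
    have : P (Rc 0) = X := by rw [← hX0, hP']
    rwa [this]

end CurvatureOperators

/-- Theorem: construction of a generalized pinching set from a continuous family of
ODE-invariant closed convex SO(n)-invariant cones. -/
theorem stmt_18 {n : ℕ} (hn : 3 ≤ n) (C : ℝ → Set (Module.End ℝ (so n)))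
    (hcurv : ∀ s ∈ Set.Ico (0 : ℝ) 1, ∀ R ∈ C s, isCurvOp R)
    (hclosed : ∀ s ∈ Set.Ico (0 : ℝ) 1, isClosedSet (C s))
    (hconv : ∀ s ∈ Set.Ico (0 : ℝ) 1, Convex ℝ (C s))
    (hcone : ∀ s ∈ Set.Ico (0 : ℝ) 1, ∀ R ∈ C s, ∀ t : ℝ, 0 ≤ t → t • R ∈ C s)
    (hSOinv : ∀ s ∈ Set.Ico (0 : ℝ) 1, ∀ g : Mat n, g * gᵀ = 1 → g.det = 1 →
      ∀ R ∈ C s, onAct g R ∈ C s)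
    (hfull : ∀ s ∈ Set.Ico (0 : ℝ) 1, ∃ R, R ∈ interiorCurv (C s))
    (hcont : ∀ s₀ ∈ Set.Ico (0 : ℝ) 1, ∀ ε > (0 : ℝ), ∃ δ > (0 : ℝ), ∀ s ∈ Set.Ico (0 : ℝ) 1,
      |s - s₀| < δ → hdClose (truncSet (C s)) (truncSet (C s₀)) ε)
    (hscal : ∀ s ∈ Set.Ico (0 : ℝ) 1, ∀ R ∈ C s, R ≠ 0 → 0 < Matrix.trace (RicM R))
    (hodeInt : ∀ s ∈ Set.Ioo (0 : ℝ) 1, ∀ R ∈ C s, R ≠ 0 →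
      Qode R ∈ interiorCurv (tangCone (C s) R))
    (ε h₀ : ℝ) (hε : ε ∈ Set.Ioo (0 : ℝ) 1) (hh₀ : 0 < h₀) :
    ∃ F : Set (Module.End ℝ (so n)),
      isClosedSet F ∧ Convex ℝ F ∧
      (∀ g : Mat n, g * gᵀ = 1 → g.det = 1 → ∀ R ∈ F, onAct g R ∈ F) ∧
      (∀ R ∈ F, isCurvOp R) ∧
      (∀ (T : ℝ) (Rc : ℝ → Module.End ℝ (so n)), 0 < T →
        (∀ t ∈ Set.Ico (0 : ℝ) T, isCurvOp (Rc t)) →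
        (∀ t ∈ Set.Ico (0 : ℝ) T, ∀ p ∈ pairs n, ∀ q ∈ pairs n,
          HasDerivWithinAt (fun u => ip (Rc u (bvec p.1 p.2)) (bvec q.1 q.2))
            (ip (Qode (Rc t) (bvec p.1 p.2)) (bvec q.1 q.2)) (Set.Ico (0 : ℝ) T) t) →
        Rc 0 ∈ F → ∀ t ∈ Set.Ico (0 : ℝ) T, Rc t ∈ F) ∧
      ({R ∈ C ε | LinearMap.trace ℝ ↥(so n) R ≤ h₀} ⊆ F) ∧
      ∀ s ∈ Set.Ico ε 1, ∃ c : ℝ, ∀ X ∈ F \ C s, endNorm X ≤ c := by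
  let _ := endNormedAddCommGroup n
  let _ := endNormedSpace n
  obtain ⟨𝓕, hC, hQ, hℓ, hG⟩ := exists_pinchingFamily hn C hcurv hclosed hconv hcone hSOinv hfull
    hcont hscal hodeInt
  obtain ⟨S, hS, hbound⟩ := PinchingFamily.exists_pinchingSet (𝓕 := 𝓕) hε hh₀
  have hεI : ε ∈ Set.Ico (0 : ℝ) 1 := ⟨hε.1.le, hε.2⟩
  refine ⟨Subtype.val '' S, ?_, ?_, ?_, ?_, ?_, ?_, ?_⟩
  · exact isClosedSet_iff.2 ((curvOps n).closed_of_finiteDimensional.isClosedEmbedding_subtypeVal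
      |>.isClosedMap _ hS.isClosed)
  · exact hS.convex.linear_image (curvOps n).subtype
  · rintro g hg hg' _ ⟨X, hX, rfl⟩
    obtain ⟨f, hf, hfg⟩ := hG g hg hg'
    exact ⟨f X, hS.symm f hf X hX, hfg X⟩
  · rintro _ ⟨X, -, rfl⟩
    exact X.2
  · intro T Rc _ hRc hderiv
    exact mem_of_odeInvariant hQ hS.invariant hRc
      fun t ht => hasDerivWithinAt_of_coord (hderiv t ht)
  · rintro R ⟨hR, hRh⟩
    exact ⟨⟨R, hcurv ε hεI R hR⟩, hS.contains ⟨(hC _ _).2 hR, (hℓ _).trans_le hRh⟩, rfl⟩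
  · intro s hs
    obtain ⟨b, hb⟩ := hbound s hs
    refine ⟨b, ?_⟩
    rintro _ ⟨⟨X, hX, rfl⟩, hXC⟩
    rw [← norm_eq_endNorm]
    exact hb X ⟨hX, fun h => hXC ((hC s X).1 h)⟩

end BW
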